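/- For any permutation ω ∈ S_n, the map sending an acyclic pipe dream P ∈ Π(ω) to its set L(P) of linear extensions is an isomorphism of directed graphs from the increasing flip graph on acyclic pipe dreams of Π(ω) to the Hasse diagram of the lattice quotient [e,ω]/≡_ω (oriented from lower to upper covers). In particular, the reflexive–transitive closure of the increasing flip graph on acyclic pipe dreams of Π(ω) is a partial order which is a lattice. -/

import Mathlib

/-- A pipe dream of size `n` on the triangular shape, with boxes indexed by pairs
`(r, c)` of a row `r` and a column `c`, both `0`-indexed (rows increase southwards,
columns increase eastwards).  `cross r c = true` means that box `(r, c)` contains a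
crossing tile; all other boxes contain elbow tiles.  Crossings are only allowed in
the full boxes of the triangular shape, i.e. those with `r + c + 2 ≤ n` (the boxes
with `r + c + 1 = n` are the half-boxes on the antidiagonal, which are forced
elbows).  The `n` pipes enter horizontally on the left side in rows `0, …, n-1` and
exit vertically on the top side in columns `0, …, n-1`; pipe `k` is the pipe
entering at row `k`.  An elbow tile connects the west edge of its box to the north
edge (the pipe travelling through this elbow passes northwest of the tile) and the
south edge to the east edge (this pipe passes southeast of the tile); a crossing
tile connects west to east and south to north. -/
structure PipeDream (n : ℕ) where
  cross : ℕ → ℕ → Bool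
  inShape : ∀ r c : ℕ, cross r c = true → r + c + 2 ≤ n

namespace PipeDream

variable {n : ℕ}

/-- `(P.pipes r c).1` is the label of the pipe entering box `(r, c)` from the west,
and `(P.pipes r c).2` is the label of the pipe entering box `(r, c)` from the south
(junk value `0` if there is no box below box `(r, c)` in the triangular shape). -/
def pipes (P : PipeDream n) : ℕ → ℕ → ℕ × ℕ
  | r, c =>
    (if hc : c = 0 then r
      else if P.cross r (c - 1) then (pipes P r (c - 1)).1 else (pipes P r (c - 1)).2,
     if hr : r + c + 2 ≤ n then
        if P.cross (r + 1) c then (pipes P (r + 1) c).2 else (pipes P (r + 1) c).1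
      else 0)
  termination_by r c => (n - r) + c
  decreasing_by all_goals omega

/-- The pipe entering box `(r, c)` from the west (travelling eastwards). -/
def west (P : PipeDream n) (r c : ℕ) : ℕ := (pipes P r c).1

/-- The pipe entering box `(r, c)` from the south (travelling northwards). -/
def south (P : PipeDream n) (r c : ℕ) : ℕ := (pipes P r c).2

/-- The pipe exiting on the top side at column `c`. -/
def exitPipe (P : PipeDream n) (c : ℕ) : ℕ :=
  if P.cross 0 c then P.south 0 c else P.west 0 c

/-- `P` has exit permutation `ω`, i.e. the pipe exiting at column `c` is `ω c`;
equivalently, pipe `k` exits at column `ω⁻¹ k`. -/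
def HasExitPerm (P : PipeDream n) (ω : Equiv.Perm (Fin n)) : Prop :=
  ∀ c : Fin n, P.exitPipe c.val = (ω c).val

/-- `P` is reduced: any two of its pipes cross at most once. -/
def Reduced (P : PipeDream n) : Prop :=
  ∀ r c r' c' : ℕ, P.cross r c = true → P.cross r' c' = true → (r, c) ≠ (r', c') →
    ¬ ((P.west r c = P.west r' c' ∧ P.south r c = P.south r' c') ∨
        (P.west r c = P.south r' c' ∧ P.south r c = P.west r' c'))

/-- The arcs of the contact graph `P♯` of `P`: there is one arc for each elbow
contact of `P` (an elbow tile in a full box of the triangular shape), oriented from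
the pipe passing northwest of the contact (the one travelling west-to-north) to the
pipe passing southeast of it (the one travelling south-to-east). -/
def Arc (P : PipeDream n) (i j : ℕ) : Prop :=
  ∃ r c : ℕ, r + c + 2 ≤ n ∧ P.cross r c = false ∧ P.west r c = i ∧ P.south r c = j

/-- `P` is acyclic: its contact graph has no directed cycle. -/
def Acyclic (P : PipeDream n) : Prop := ∀ i : ℕ, ¬ Relation.TransGen P.Arc i i

/-- `i ⪯_P j` : there is a directed path (possibly empty) from `i` to `j` in the
contact graph of `P`. -/
def Path (P : PipeDream n) (i j : ℕ) : Prop := Relation.ReflTransGen P.Arc i j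

/-- `π` is a linear extension of `P` : `π⁻¹ i < π⁻¹ j` for every arc `i → j` of the
contact graph of `P`. -/
def LinExt (P : PipeDream n) (π : Equiv.Perm (Fin n)) : Prop :=
  ∀ i j : Fin n, P.Arc i.val j.val → π⁻¹ i < π⁻¹ j

/-- There is a contact (an elbow tile in a full box) between pipes `i` and `j`
at box `b`. -/
def ContactAt (P : PipeDream n) (i j : ℕ) (b : ℕ × ℕ) : Prop :=
  b.1 + b.2 + 2 ≤ n ∧ P.cross b.1 b.2 = false ∧
    ((P.west b.1 b.2 = i ∧ P.south b.1 b.2 = j) ∨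
      (P.west b.1 b.2 = j ∧ P.south b.1 b.2 = i))

/-- `P'` is obtained from `P` by the flip exchanging the contact at box `b` with the
crossing at box `b'` (a contact and a crossing between the same two pipes). -/
def IsFlip (P P' : PipeDream n) (b b' : ℕ × ℕ) : Prop :=
  b ≠ b' ∧
  P.cross b.1 b.2 = false ∧ P.cross b'.1 b'.2 = true ∧
  P'.cross b.1 b.2 = true ∧ P'.cross b'.1 b'.2 = false ∧
  (∀ r c : ℕ, (r, c) ≠ b → (r, c) ≠ b' → P.cross r c = P'.cross r c) ∧
  ((P.west b.1 b.2 = P.west b'.1 b'.2 ∧ P.south b.1 b.2 = P.south b'.1 b'.2) ∨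
    (P.west b.1 b.2 = P.south b'.1 b'.2 ∧ P.south b.1 b.2 = P.west b'.1 b'.2))

/-- There is an increasing flip from `P` to `P'`: a flip exchanging a contact at a
box `b` weakly southwest of the box `b'` of the corresponding crossing. -/
def IncFlip (P P' : PipeDream n) : Prop :=
  ∃ b b' : ℕ × ℕ, P.IsFlip P' b b' ∧ b'.1 ≤ b.1 ∧ b.2 ≤ b'.2

end PipeDream

/-- The weak order on permutations of `Fin n` : `π ≤ σ` if and only if
`Inv(π) ⊆ Inv(σ)`, where `Inv(π)` is the set of pairs `(i, j)` with `i < j` and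
`π⁻¹ i > π⁻¹ j`. -/
def WeakLE {n : ℕ} (π σ : Equiv.Perm (Fin n)) : Prop :=
  ∀ i j : Fin n, i < j → π⁻¹ j < π⁻¹ i → σ⁻¹ j < σ⁻¹ i

/-- `P` is an acyclic reduced pipe dream of `Π(ω)`. -/
def GoodPD {n : ℕ} (ω : Equiv.Perm (Fin n)) (P : PipeDream n) : Prop :=
  P.Reduced ∧ P.HasExitPerm ω ∧ P.Acyclic

/-- The order of the lattice quotient `[e, ω]/≡_ω` read on the acyclic pipe dreams:
the class `L(P)` is below the class `L(Q)` when some linear extension of `P` is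
below some linear extension of `Q` in the weak order. -/
def QuotLE {n : ℕ} (P Q : PipeDream n) : Prop :=
  ∃ π π' : Equiv.Perm (Fin n), P.LinExt π ∧ Q.LinExt π' ∧ WeakLE π π'

/-- `P` and `Q` have the same class of linear extensions. -/
def SameClass {n : ℕ} (P Q : PipeDream n) : Prop :=
  ∀ π : Equiv.Perm (Fin n), P.LinExt π ↔ Q.LinExt π

/-- The class `L(Q)` covers the class `L(P)` in the lattice quotient `[e, ω]/≡_ω` :
`L(P) < L(Q)` and no class lies strictly in between. -/
def QuotCovBy {n : ℕ} (ω : Equiv.Perm (Fin n)) (P Q : PipeDream n) : Prop :=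
  (QuotLE P Q ∧ ¬ SameClass P Q) ∧
  ∀ R : PipeDream n, GoodPD ω R →
    (QuotLE P R ∧ ¬ SameClass P R) → (QuotLE R Q ∧ ¬ SameClass R Q) → False

/-- An arc of the increasing flip graph on the acyclic pipe dreams of `Π(ω)`. -/
def FlipStep {n : ℕ} (ω : Equiv.Perm (Fin n)) (P Q : PipeDream n) : Prop :=
  GoodPD ω P ∧ GoodPD ω Q ∧ PipeDream.IncFlip P Q



namespace PipeDream

variable {n : ℕ}

/-- label on the top side of box `(r, c)` -/
def up (P : PipeDream n) (r c : ℕ) : ℕ := if P.cross r c then P.south r c else P.west r c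

theorem cross_false (P : PipeDream n) {r c : ℕ} (h : n < r + c + 2) : P.cross r c = false := by
  cases hc : P.cross r c with
  | false => rfl
  | true => have := P.inShape r c hc; omega

theorem west_zero (P : PipeDream n) (r : ℕ) : P.west r 0 = r := by
  unfold west; rw [pipes]; simp

theorem west_succ (P : PipeDream n) (r c : ℕ) :
    P.west r (c + 1) = if P.cross r c then P.west r c else P.south r c := by
  unfold west south; rw [pipes]; simp

theorem south_eq (P : PipeDream n) {r c : ℕ} (h : r + c + 2 ≤ n) :
    P.south r c = P.up (r + 1) c := by
  unfold up west south; rw [pipes]; simp [h]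

theorem up_cross (P : PipeDream n) {r c : ℕ} (h : P.cross r c = true) :
    P.up r c = P.up (r + 1) c := by
  rw [← P.south_eq (P.inShape r c h)]; simp [up, h]

theorem up_elbow (P : PipeDream n) {r c : ℕ} (h : P.cross r c = false) :
    P.up r c = P.west r c := by
  simp [up, h]

theorem west_cross (P : PipeDream n) {r c : ℕ} (h : P.cross r c = true) :
    P.west r (c + 1) = P.west r c := by
  rw [west_succ]; simp [h]

theorem west_elbow (P : PipeDream n) {r c : ℕ} (h : P.cross r c = false) (h2 : r + c + 2 ≤ n) :
    P.west r (c + 1) = P.up (r + 1) c := by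
  rw [west_succ, ← P.south_eq h2]; simp [h]

theorem west_origin (P : PipeDream n) (r : ℕ) : ∀ c : ℕ, r + c < n →
    (P.west r c = r ∧ ∀ x < c, P.cross r x = true) ∨
    ∃ c0 < c, P.cross r c0 = false ∧ P.west r c = P.up (r + 1) c0 ∧
      ∀ x, c0 < x → x < c → P.cross r x = true := by
  intro c
  induction c with
  | zero => intro _; left; exact ⟨P.west_zero r, by intro x hx; omega⟩
  | succ c ih =>
    intro h
    cases hc : P.cross r c with
    | false =>
      right
      exact ⟨c, by omega, hc, P.west_elbow hc (by omega), by intro x h1 h2; omega⟩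
    | true =>
      rw [P.west_cross hc]
      rcases ih (by omega) with ⟨h1, h2⟩ | ⟨c0, h1, h2, h3, h4⟩
      · left; refine ⟨h1, fun x hx => ?_⟩
        rcases Nat.lt_succ_iff_lt_or_eq.1 hx with h | h
        · exact h2 x h
        · rw [h]; exact hc
      · right; refine ⟨c0, by omega, h2, h3, fun x hx hx2 => ?_⟩
        rcases Nat.lt_succ_iff_lt_or_eq.1 hx2 with h | h
        · exact h4 x hx h
        · rw [h]; exact hc

theorem up_main (P : PipeDream n) : ∀ k r : ℕ, r + k = n →
    (∀ c, r + c < n → r ≤ P.up r c ∧ P.up r c < n) ∧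
    (∀ c c', c < c' → r + c' < n → P.up r c ≠ P.up r c') := by
  intro k
  induction k with
  | zero => intro r hr; constructor <;> intros <;> omega
  | succ k ih =>
    intro r hr
    obtain ⟨h1, h2⟩ := ih (r + 1) (by omega)
    have h3 : ∀ c c', r + 1 + c < n → r + 1 + c' < n → P.up (r+1) c = P.up (r+1) c' → c = c' := by
      intro c c' hc hc' he
      by_contra hne
      rcases Nat.lt_or_gt_of_ne hne with h | h
      · exact h2 c c' h hc' he
      · exact h2 c' c h hc he.symm
    constructor
    · intro c hc
      cases hcr : P.cross r c with
      | true =>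
        rw [P.up_cross hcr]
        have := h1 c (by have := P.inShape r c hcr; omega)
        omega
      | false =>
        rw [P.up_elbow hcr]
        rcases P.west_origin r c hc with ⟨h, _⟩ | ⟨c0, h4, h5, h6, _⟩
        · omega
        · rw [h6]; have := h1 c0 (by omega); omega
    · intro c c' hcc hc' he
      cases hcr : P.cross r c with
      | true =>
        have hin := P.inShape r c hcr
        rw [P.up_cross hcr] at he
        cases hcr' : P.cross r c' with
        | true =>
          have hin' := P.inShape r c' hcr'
          rw [P.up_cross hcr'] at he
          have := h3 _ _ (by omega) (by omega) he; omega
        | false =>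
          rw [P.up_elbow hcr'] at he
          rcases P.west_origin r c' hc' with ⟨h, _⟩ | ⟨c0, h4, h5, h6, _⟩
          · have := h1 c (by omega); omega
          · rw [h6] at he
            have := h3 _ _ (by omega) (by omega) he
            rw [this, h5] at hcr; exact absurd hcr (by decide)
      | false =>
        rw [P.up_elbow hcr] at he
        cases hcr' : P.cross r c' with
        | true =>
          have hin' := P.inShape r c' hcr'
          rw [P.up_cross hcr'] at he
          rcases P.west_origin r c (by omega) with ⟨h, _⟩ | ⟨c0, h4, h5, h6, _⟩
          · have := h1 c' (by omega); omega
          · rw [h6] at he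
            have := h3 _ _ (by omega) (by omega) he
            omega
        | false =>
          rw [P.up_elbow hcr'] at he
          rcases P.west_origin r c' hc' with ⟨h, h7⟩ | ⟨c0', h4', h5', h6', h7'⟩
          · have := h7 c hcc; rw [hcr] at this; exact absurd this (by decide)
          · have hle : c ≤ c0' := by
              by_contra hlt
              have := h7' c (by omega) hcc; rw [hcr] at this; exact absurd this (by decide)
            rw [h6'] at he
            rcases P.west_origin r c (by omega) with ⟨h, _⟩ | ⟨c0, h4, h5, h6, _⟩
            · have := h1 c0' (by omega); omega
            · rw [h6] at he
              have := h3 _ _ (by omega) (by omega) he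
              omega

theorem up_ge (P : PipeDream n) {r c : ℕ} (h : r + c < n) : r ≤ P.up r c :=
  ((P.up_main (n - r) r (by omega)).1 c h).1

theorem up_lt (P : PipeDream n) {r c : ℕ} (h : r + c < n) : P.up r c < n :=
  ((P.up_main (n - r) r (by omega)).1 c h).2

theorem up_inj (P : PipeDream n) {r c c' : ℕ} (h : r + c < n) (h' : r + c' < n)
    (he : P.up r c = P.up r c') : c = c' := by
  by_contra hne
  have hm := (P.up_main (n - r) r (by omega)).2
  rcases Nat.lt_or_gt_of_ne hne with h1 | h1
  · exact hm c c' h1 h' he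
  · exact hm c' c h1 h he.symm

theorem up_surj (P : PipeDream n) {r v : ℕ} (h : r ≤ v) (hv : v < n) :
    ∃ c, r + c < n ∧ P.up r c = v := by
  have hs := Finset.surj_on_of_inj_on_of_card_le (s := Finset.range (n - r)) (t := Finset.Ico r n)
    (fun c _ => P.up r c)
    (by
      intro c hc
      simp only [Finset.mem_range] at hc
      simp only [Finset.mem_Ico]
      exact ⟨P.up_ge (by omega), P.up_lt (by omega)⟩)
    (by
      intro a b ha hb he
      simp only [Finset.mem_range] at ha hb
      exact P.up_inj (by omega) (by omega) he)
    (by simp)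
    v (by simp only [Finset.mem_Ico]; omega)
  obtain ⟨c, hc, he⟩ := hs
  simp only [Finset.mem_range] at hc
  exact ⟨c, by omega, he.symm⟩

/-- column of label `v` on top of row `r` -/
noncomputable def pos (P : PipeDream n) (r v : ℕ) : ℕ := sInf {c | r + c < n ∧ P.up r c = v}

theorem pos_spec (P : PipeDream n) {r v : ℕ} (h : r ≤ v) (hv : v < n) :
    r + P.pos r v < n ∧ P.up r (P.pos r v) = v := by
  have : P.pos r v ∈ {c | r + c < n ∧ P.up r c = v} := Nat.sInf_mem (P.up_surj h hv)
  exact this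

theorem pos_lt (P : PipeDream n) {r v : ℕ} (h : r ≤ v) (hv : v < n) : r + P.pos r v < n :=
  (P.pos_spec h hv).1

theorem up_pos (P : PipeDream n) {r v : ℕ} (h : r ≤ v) (hv : v < n) : P.up r (P.pos r v) = v :=
  (P.pos_spec h hv).2

theorem pos_up (P : PipeDream n) {r c : ℕ} (h : r + c < n) : P.pos r (P.up r c) = c := by
  have h2 := P.pos_spec (P.up_ge h) (P.up_lt h)
  exact P.up_inj h2.1 h h2.2

theorem pos_eq (P : PipeDream n) {r c v : ℕ} (h : r + c < n) (he : P.up r c = v) :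
    P.pos r v = c := by
  rw [← he]; exact P.pos_up h

theorem pos_ne (P : PipeDream n) {r u v : ℕ} (hu : r ≤ u) (hun : u < n) (hv : r ≤ v) (hvn : v < n)
    (h : u ≠ v) : P.pos r u ≠ P.pos r v := by
  intro he
  apply h
  rw [← P.up_pos hu hun, ← P.up_pos hv hvn, he]

/-- a pipe traveling east in row `r` turns north at its column on top of row `r` -/
theorem west_run (P : PipeDream n) {r v : ℕ} : ∀ k c : ℕ, r + c + k + 1 = n → P.west r c = v →
    c ≤ P.pos r v ∧ P.cross r (P.pos r v) = false ∧
    ∀ x, c ≤ x → x ≤ P.pos r v → P.west r x = v ∧ (x < P.pos r v → P.cross r x = true) := by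
  intro k
  induction k with
  | zero =>
    intro c hc hw
    have hcr : P.cross r c = false := P.cross_false (by omega)
    have hp : P.pos r v = c := P.pos_eq (by omega) (by rw [P.up_elbow hcr, hw])
    rw [hp]
    refine ⟨le_refl _, hcr, fun x h1 h2 => ?_⟩
    have : x = c := by omega
    subst this
    exact ⟨hw, by intro h; omega⟩
  | succ k ih =>
    intro c hc hw
    cases hcr : P.cross r c with
    | false =>
      have hp : P.pos r v = c := P.pos_eq (by omega) (by rw [P.up_elbow hcr, hw])
      rw [hp]
      refine ⟨le_refl _, hcr, fun x h1 h2 => ?_⟩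
      have : x = c := by omega
      subst this
      exact ⟨hw, by intro h; omega⟩
    | true =>
      have := ih (c + 1) (by omega) (by rw [P.west_cross hcr, hw])
      refine ⟨by omega, this.2.1, fun x h1 h2 => ?_⟩
      by_cases hx : x = c
      · subst hx; exact ⟨hw, fun _ => hcr⟩
      · exact this.2.2 x (by omega) h2

theorem pos_stay (P : PipeDream n) {r v : ℕ} (h : r < v) (hv : v < n)
    (hc : P.cross r (P.pos (r + 1) v) = true) : P.pos r v = P.pos (r + 1) v := by
  have := P.pos_spec (r := r + 1) h hv
  exact P.pos_eq (by omega) (by rw [P.up_cross hc]; exact this.2)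

theorem pos_move (P : PipeDream n) {r v : ℕ} (h : r < v) (hv : v < n)
    (hc : P.cross r (P.pos (r + 1) v) = false) :
    P.west r (P.pos (r + 1) v + 1) = v ∧ P.pos (r + 1) v < P.pos r v := by
  have h1 := P.pos_spec (r := r + 1) h hv
  have hw : P.west r (P.pos (r + 1) v + 1) = v := by
    rw [P.west_elbow hc (by omega)]; exact h1.2
  have := (P.west_run (n - 1 - r - (P.pos (r + 1) v + 1)) _ (by omega) hw).1
  exact ⟨hw, by omega⟩

theorem pos_mono (P : PipeDream n) {r v : ℕ} (h : r < v) (hv : v < n) :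
    P.pos (r + 1) v ≤ P.pos r v := by
  cases hc : P.cross r (P.pos (r + 1) v) with
  | false => exact le_of_lt (P.pos_move h hv hc).2
  | true => exact le_of_eq (P.pos_stay h hv hc).symm

theorem cross_iff_stay (P : PipeDream n) {r v : ℕ} (h : r < v) (hv : v < n) :
    P.cross r (P.pos (r + 1) v) = true ↔ P.pos r v = P.pos (r + 1) v := by
  constructor
  · exact P.pos_stay h hv
  · intro he
    cases hc : P.cross r (P.pos (r + 1) v) with
    | false => have := (P.pos_move h hv hc).2; omega
    | true => rfl

/-- `v` travels east somewhere in row `r` -/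
def Active (P : PipeDream n) (r v : ℕ) : Prop :=
  v < n ∧ (v = r ∨ (r < v ∧ P.pos (r + 1) v < P.pos r v))

theorem active_self (P : PipeDream n) {r : ℕ} (h : r < n) : P.Active r r := ⟨h, Or.inl rfl⟩

theorem run (P : PipeDream n) {r v : ℕ} (h : P.Active r v) :
    P.cross r (P.pos r v) = false ∧
    ∀ x, x ≤ P.pos r v → (v = r ∨ P.pos (r + 1) v < x) →
      P.west r x = v ∧ (x < P.pos r v → P.cross r x = true) := by
  obtain ⟨hv, he | ⟨h1, h2⟩⟩ := h
  · subst he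
    have := P.west_run (n - 1 - v) 0 (by omega) (P.west_zero v)
    exact ⟨this.2.1, fun x hx _ => this.2.2 x (by omega) hx⟩
  · have hc : P.cross r (P.pos (r + 1) v) = false := by
      cases hc : P.cross r (P.pos (r + 1) v) with
      | false => rfl
      | true => have := P.pos_stay h1 hv hc; omega
    have hm := P.pos_move h1 hv hc
    have hl := P.pos_lt (le_of_lt h1) hv
    have := P.west_run (n - 1 - r - (P.pos (r + 1) v + 1)) _ (by omega) hm.1
    refine ⟨this.2.1, fun x hx hx2 => ?_⟩
    exact this.2.2 x (by omega) hx

theorem active_of_west (P : PipeDream n) {r c v : ℕ} (hc : r + c < n) (hw : P.west r c = v) :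
    P.Active r v ∧ c ≤ P.pos r v ∧ (v = r ∨ (r < v ∧ P.pos (r + 1) v < c)) := by
  have hle := (P.west_run (n - 1 - r - c) c (by omega) hw).1
  rcases P.west_origin r c hc with ⟨h1, h2⟩ | ⟨c0, h1, h2, h3, h4⟩
  · have : v = r := by omega
    subst this
    exact ⟨P.active_self (by omega), hle, Or.inl rfl⟩
  · have h5 : P.pos (r + 1) v = c0 := P.pos_eq (by omega) (by omega)
    have h6 := P.up_ge (r := r + 1) (c := c0) (by omega)
    have h7 := P.up_lt (r := r + 1) (c := c0) (by omega)
    exact ⟨⟨by omega, Or.inr ⟨by omega, by omega⟩⟩, hle, Or.inr ⟨by omega, by omega⟩⟩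

theorem active_arc (P : PipeDream n) {r u v : ℕ} (h : P.Active r v) (hu : r < u) (hun : u < n)
    (he : P.pos (r + 1) u = P.pos r v) : P.Arc v u ∧ P.Active r u := by
  have h1 := P.run h
  have h2 := P.pos_spec (r := r + 1) hu hun
  have h3 : P.cross r (P.pos (r + 1) u) = false := by rw [he]; exact h1.1
  refine ⟨⟨r, P.pos r v, by omega, h1.1, ?_, ?_⟩, hun, Or.inr ⟨hu, (P.pos_move hu hun h3).2⟩⟩
  · exact (h1.2 _ (le_refl _) (by rcases h.2 with h | h; exact Or.inl h; exact Or.inr h.2)).1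
  · rw [P.south_eq (by omega), ← he]; exact h2.2

theorem active_cross (P : PipeDream n) {r u v : ℕ} (h : P.Active r v) (hu : r < u) (hun : u < n)
    (h1 : v = r ∨ P.pos (r + 1) v < P.pos (r + 1) u) (h2 : P.pos (r + 1) u < P.pos r v) :
    P.cross r (P.pos (r + 1) u) = true ∧ P.west r (P.pos (r + 1) u) = v ∧
    P.south r (P.pos (r + 1) u) = u ∧ P.pos r u = P.pos (r + 1) u := by
  have h3 := (P.run h).2 _ (le_of_lt h2) h1
  have hc := h3.2 h2
  refine ⟨hc, h3.1, ?_, P.pos_stay hu hun hc⟩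
  rw [P.south_eq (P.inShape _ _ hc)]
  exact P.up_pos hu hun

theorem cross_data (P : PipeDream n) {r c u v : ℕ} (hc : P.cross r c = true)
    (hw : P.west r c = v) (hs : P.south r c = u) :
    P.Active r v ∧ u < n ∧ r < u ∧ P.pos (r + 1) u = c ∧ P.pos r u = c ∧ c < P.pos r v ∧
    (v = r ∨ (r < v ∧ P.pos (r + 1) v < c)) := by
  have hin := P.inShape _ _ hc
  have h1 := P.active_of_west (r := r) (c := c) (by omega) hw
  rw [P.south_eq hin] at hs
  have h2 := P.up_ge (r := r + 1) (c := c) (by omega)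
  have h3 := P.up_lt (r := r + 1) (c := c) (by omega)
  have h4 : P.pos (r + 1) u = c := P.pos_eq (by omega) hs
  have h5 : P.pos r u = c := P.pos_eq (by omega) (by rw [P.up_cross hc]; exact hs)
  refine ⟨h1.1, by omega, by omega, h4, h5, ?_, h1.2.2⟩
  have := (P.run h1.1).1
  rcases Nat.lt_or_eq_of_le h1.2.1 with h | h
  · exact h
  · rw [← h, hc] at this; exact absurd this (by decide)

theorem arc_data (P : PipeDream n) {r c i j : ℕ} (hin : r + c + 2 ≤ n) (hc : P.cross r c = false)
    (hw : P.west r c = i) (hs : P.south r c = j) :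
    P.Active r i ∧ P.Active r j ∧ r < j ∧ P.pos r i = c ∧ P.pos (r + 1) j = c ∧ c < P.pos r j ∧
    (i = r ∨ (r < i ∧ P.pos (r + 1) i < c)) := by
  have h1 := P.active_of_west (r := r) (c := c) (by omega) hw
  rw [P.south_eq hin] at hs
  have h2 := P.up_ge (r := r + 1) (c := c) (by omega)
  have h3 := P.up_lt (r := r + 1) (c := c) (by omega)
  have h4 : P.pos (r + 1) j = c := P.pos_eq (by omega) hs
  have h5 : P.pos r i = c := P.pos_eq (by omega) (by rw [P.up_elbow hc]; exact hw)
  have h6 := (P.pos_move (r := r) (v := j) (by omega) (by omega) (by rw [h4]; exact hc)).2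
  refine ⟨h1.1, ⟨by omega, Or.inr ⟨by omega, by omega⟩⟩, by omega, h5, h4, by omega, h1.2.2⟩

theorem Arc.lt (P : PipeDream n) {i j : ℕ} (h : P.Arc i j) : i < n ∧ j < n ∧ i ≠ j := by
  obtain ⟨r, c, h1, h2, h3, h4⟩ := h
  have := P.arc_data h1 h2 h3 h4
  refine ⟨this.1.1, this.2.1.1, ?_⟩
  rintro rfl
  omega

/-- local form of reducedness -/
def Red (P : PipeDream n) : Prop := ∀ r c, P.cross r c = true → P.west r c < P.south r c

theorem exists_cross (P : PipeDream n) {i j : ℕ} (hij : i < j) (hj : j < n) :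
    ∀ k r, r + k = i → P.pos r j < P.pos r i →
    ∃ r' c', r ≤ r' ∧ P.cross r' c' = true ∧ P.west r' c' = i ∧ P.south r' c' = j := by
  intro k
  induction k with
  | zero =>
    intro r hr h
    have : r = i := by omega
    subst this
    have hm := P.pos_mono hij hj
    have := P.active_cross (P.active_self (r := r) (by omega)) hij hj (Or.inl rfl) (by omega)
    exact ⟨r, _, le_refl _, this.1, this.2.1, this.2.2.1⟩
  | succ k ih =>
    intro r hr h
    by_cases hinv : P.pos (r + 1) j < P.pos (r + 1) i
    · obtain ⟨r', c', h1, h2⟩ := ih (r + 1) (by omega) hinv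
      exact ⟨r', c', by omega, h2⟩
    · have hne := P.pos_ne (r := r + 1) (u := j) (v := i) (by omega) hj (by omega) (by omega) (by omega)
      have hm := P.pos_mono (r := r) (v := j) (by omega) hj
      have hact : P.Active r i := ⟨by omega, Or.inr ⟨by omega, by omega⟩⟩
      have := P.active_cross hact (u := j) (by omega) hj (Or.inr (by omega)) (by omega)
      exact ⟨r, _, le_refl _, this.1, this.2.1, this.2.2.1⟩

theorem Reduced.red {P : PipeDream n} (h : P.Reduced) : P.Red := by
  intro r c hc
  by_contra hlt
  obtain ⟨h1, h2, h3, h4, h5, h6, h7⟩ := P.cross_data hc rfl rfl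
  have hne : P.west r c ≠ P.south r c := by
    intro he
    rw [he] at h6; omega
  have h8 : P.pos (r + 1) (P.west r c) < P.pos (r + 1) (P.south r c) := by omega
  obtain ⟨r', c', g1, g2, g3, g4⟩ := P.exists_cross (i := P.south r c) (j := P.west r c)
    (by omega) h1.1 (P.south r c - (r + 1)) (r + 1) (by omega) h8
  refine h r c r' c' hc g2 ?_ (Or.inr ⟨g4.symm, g3.symm⟩)
  intro he
  have := congrArg Prod.fst he
  simp at this; omega

/-- one-step persistence of inversions -/
theorem Red.persist1 {P : PipeDream n} (h : P.Red) {r u v : ℕ} (huv : u < v) (hv : v < n)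
    (hr : r < u) (hp : P.pos (r + 1) v < P.pos (r + 1) u) : P.pos r v < P.pos r u := by
  have h1 := P.pos_mono (r := r) (v := u) hr (by omega)
  have h2 := P.pos_mono (r := r) (v := v) (by omega) hv
  by_contra hcon
  have hact : P.Active r v := ⟨by omega, Or.inr ⟨by omega, by omega⟩⟩
  by_cases he : P.pos (r + 1) u = P.pos r v
  · have := (P.active_arc hact hr (by omega) he).2
    rcases this.2 with h | h <;> omega
  · have := P.active_cross hact (u := u) hr (by omega) (Or.inr hp) (by omega)
    have h3 := h _ _ this.1
    omega

theorem Red.persist {P : PipeDream n} (h : P.Red) {u v : ℕ} (huv : u < v) (hv : v < n)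
    {r r' : ℕ} (hr : r ≤ u) (hp : P.pos r v < P.pos r u) (hr' : r' ≤ r) :
    P.pos r' v < P.pos r' u := by
  induction r, hr' using Nat.le_induction with
  | base => exact hp
  | succ m hm ih => exact ih (by omega) (h.persist1 huv hv (by omega) hp)

theorem Red.reduced {P : PipeDream n} (h : P.Red) : P.Reduced := by
  have key : ∀ r c r' c', P.cross r c = true → P.cross r' c' = true →
      P.west r c = P.west r' c' → P.south r c = P.south r' c' → ¬ r < r' := by
    intro r c r' c' hc hc' hw hs hlt
    obtain ⟨h1, h2, h3, h4, h5, h6, h7⟩ := P.cross_data hc hw hs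
    obtain ⟨g1, g2, g3, g4, g5, g6, g7⟩ := P.cross_data hc' rfl rfl
    have hl := h _ _ hc'
    have := h.persist (u := P.west r' c') (v := P.south r' c') hl g2 (r := r') (r' := r + 1) (by omega) (by omega) (by omega)
    omega
  intro r c r' c' hc hc' hne hcon
  have hl := h _ _ hc
  have hl' := h _ _ hc'
  rcases hcon with ⟨hw, hs⟩ | ⟨hw, hs⟩
  · have k1 := key _ _ _ _ hc hc' hw hs
    have k2 := key _ _ _ _ hc' hc hw.symm hs.symm
    have hrr : r = r' := by omega
    subst hrr
    obtain ⟨h1, h2, h3, h4, h5, h6, h7⟩ := P.cross_data hc hw hs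
    obtain ⟨g1, g2, g3, g4, g5, g6, g7⟩ := P.cross_data hc' rfl rfl
    apply hne
    exact congrArg (Prod.mk r) (h4.symm.trans g4)
  · omega

theorem reduced_iff_red (P : PipeDream n) : P.Reduced ↔ P.Red := ⟨Reduced.red, Red.reduced⟩

end PipeDream


namespace PipeDream

variable {n : ℕ}

theorem Path.trans' {P : PipeDream n} {a b c : ℕ} (h : P.Path a b) (h' : P.Path b c) : P.Path a c :=
  Relation.ReflTransGen.trans h h'

theorem Arc.path {P : PipeDream n} {a b : ℕ} (h : P.Arc a b) : P.Path a b :=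
  Relation.ReflTransGen.single h

theorem Path.rfl' {P : PipeDream n} {a : ℕ} : P.Path a a := Relation.ReflTransGen.refl

theorem Acyclic.antisymm {P : PipeDream n} (h : P.Acyclic) {a b : ℕ} (h1 : P.Path a b)
    (h2 : P.Path b a) : a = b := by
  rcases Relation.reflTransGen_iff_eq_or_transGen.1 h1 with h3 | h3
  · exact h3.symm
  · exact absurd (Relation.TransGen.trans_left h3 h2) (h a)

theorem pos_mono' (P : PipeDream n) {r r' v : ℕ} (hr : r' ≤ r) (h : r ≤ v) (hv : v < n) :
    P.pos r v ≤ P.pos r' v := by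
  induction r, hr using Nat.le_induction with
  | base => exact le_refl _
  | succ m hm ih => exact le_trans (P.pos_mono (by omega) hv) (ih (by omega))

theorem Red.f4row {P : PipeDream n} (h : P.Red) {r : ℕ}
    (H : ∀ u v, r + 1 ≤ u → u < v → v < n → P.pos (r + 1) u < P.pos (r + 1) v → P.Path u v) :
    ∀ k u v, u < n → r < u → P.Active r v → (r < v → P.pos (r + 1) v < P.pos (r + 1) u) →
      (v = r → P.pos r v ≤ P.pos (r + 1) u) → P.pos (r + 1) u ≤ P.pos r v + k → P.Path v u := by
  intro k
  induction k with
  | zero =>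
    intro u v hu hru hact h1 h2 hk
    by_cases he : P.pos (r + 1) u = P.pos r v
    · exact (P.active_arc hact hru hu he).1.path
    · have hrv : r < v := by
        rcases hact.2 with h | h <;> omega
      have := P.active_cross hact hru hu (Or.inr (h1 hrv)) (by omega)
      have hl := h _ _ this.1
      exact H v u hrv (by omega) hu (h1 hrv)
  | succ k ih =>
    intro u v hu hru hact h1 h2 hk
    by_cases hk2 : P.pos (r + 1) u ≤ P.pos r v
    · exact ih u v hu hru hact h1 h2 (by omega)
    · have hs := P.pos_lt (r := r + 1) hru hu
      have hw1 := P.up_ge (r := r + 1) (c := P.pos r v) (by omega)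
      have hw2 := P.up_lt (r := r + 1) (c := P.pos r v) (by omega)
      have hw3 := P.pos_up (r := r + 1) (c := P.pos r v) (by omega)
      set w := P.up (r + 1) (P.pos r v) with hw
      obtain ⟨ha, hact2⟩ := P.active_arc hact (u := w) hw1 hw2 hw3
      refine ha.path.trans' (ih u w hu hru hact2 (by omega) (by omega) ?_)
      rcases hact2.2 with h | h <;> omega

/-- non-inversions at level `r` give paths -/
theorem Red.f3 {P : PipeDream n} (h : P.Red) {r u v : ℕ} (hr : r ≤ u) (huv : u < v) (hv : v < n)
    (hp : P.pos r u < P.pos r v) : P.Path u v := by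
  have key : ∀ k r, r + k = n → ∀ u v, r ≤ u → u < v → v < n → P.pos r u < P.pos r v →
      P.Path u v := by
    intro k
    induction k with
    | zero => intros; omega
    | succ k ih =>
      intro r hrk u v hr huv hv hp
      have H := ih (r + 1) (by omega)
      by_cases hur : r < u
      · refine H u v hur huv hv ?_
        by_contra hcon
        have hne := P.pos_ne (r := r + 1) (u := u) (v := v) (by omega) (by omega) (by omega) hv (by omega)
        have := h.persist1 huv hv hur (by omega)
        omega
      · have : u = r := by omega
        subst this
        have hle : P.pos u u ≤ P.pos (u + 1) v := by
          by_contra hcon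
          have := P.active_cross (P.active_self (by omega)) huv hv (Or.inl rfl) (by omega)
          omega
        exact h.f4row H (P.pos (u + 1) v) v u hv huv (P.active_self (by omega)) (by omega)
          (fun _ => hle) (by omega)
  exact key (n - r) r (by omega) u v hr huv hv hp

/-- if `v` is left of `u` at level `r` and moves later then `v ⪯ u` -/
theorem Red.f4 {P : PipeDream n} (h : P.Red) {r r' u v : ℕ} (hr' : r' ≤ r) (hu : r ≤ u)
    (hun : u < n) (hv : r ≤ v) (hvn : v < n)
    (hp : P.pos r v < P.pos r u) (hm : P.pos r' v ≠ P.pos r v) : P.Path v u := by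
  induction r, hr' using Nat.le_induction with
  | base => exact absurd rfl hm
  | succ m hmm ih =>
    have h1 := P.pos_mono (r := m) (v := u) (by omega) hun
    have h2 := P.pos_mono (r := m) (v := v) (by omega) hvn
    by_cases hs : P.pos m v = P.pos (m + 1) v
    · exact ih (by omega) (by omega) (by omega) (by omega)
    · exact h.f4row (r := m) (fun a b ha hab hb hpp => h.f3 ha hab hb hpp) (P.pos (m + 1) u) u v hun
        (by omega) ⟨hvn, Or.inr ⟨by omega, by omega⟩⟩ (by omega) (by omega) (by omega)

theorem Red.f4' {P : PipeDream n} (h : P.Red) {r R u v : ℕ} (hR : R < r) (hu : r ≤ u)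
    (hun : u < n) (hv : r ≤ v) (hact : P.Active R v)
    (hp : P.pos r v < P.pos r u) : P.Path v u := by
  have hvn := hact.1
  have h1 := P.pos_mono' (r := r) (r' := R + 1) (v := v) (by omega) hv hvn
  refine h.f4 (r' := R) (by omega) hu hun hv hvn hp ?_
  rcases hact.2 with h | h <;> omega

theorem Path.lt {P : PipeDream n} {a b : ℕ} (h : P.Path a b) (hne : a ≠ b) : a < n ∧ b < n := by
  constructor
  · rcases Relation.ReflTransGen.cases_head h with h | ⟨c, h, _⟩
    · exact absurd h hne
    · exact (Arc.lt P h).1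
  · rcases Relation.ReflTransGen.cases_tail h with h | ⟨c, _, h⟩
    · exact absurd h.symm hne
    · exact (Arc.lt P h).2.1

theorem g1 {P : PipeDream n} (h : P.Red) (ha : P.Acyclic) {u v : ℕ} (huv : u < v)
    (hp : P.Path v u) : P.pos u v < P.pos u u := by
  by_contra hcon
  have hv := (hp.lt (by omega)).1
  have hne := P.pos_ne (r := u) (u := u) (v := v) (le_refl _) (by omega) (by omega) hv (by omega)
  have := ha.antisymm hp (h.f3 (le_refl _) huv hv (by omega))
  omega

theorem g2 {P : PipeDream n} (h : P.Red) (ha : P.Acyclic) {u v : ℕ} (huv : u < v)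
    (hp : P.Path v u) : ∃ d, u < d ∧ d < n ∧ P.Path v d ∧ P.pos u d < P.pos u u ∧
      P.pos 0 d ≠ P.pos u d ∧ P.Path d u := by
  have key : ∀ v, P.Path v u → u < v → ∃ d, u < d ∧ d < n ∧ P.Path v d ∧ P.pos u d < P.pos u u ∧
      P.pos 0 d ≠ P.pos u d ∧ P.Path d u := by
    intro v hp
    induction hp using Relation.ReflTransGen.head_induction_on with
    | refl => intro h; omega
    | @head a c hac hcu ih =>
      intro hua
      have hau : P.Path a u := hac.path.trans' hcu
      have hlt := hau.lt (by omega)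
      have hg := g1 h ha hua hau
      by_cases hs : P.pos 0 a = P.pos u a
      · obtain ⟨r, γ, h1, h2, h3, h4⟩ := id hac
        obtain ⟨g1, g2, g3, g4, g5, g6, g7⟩ := P.arc_data h1 h2 h3 h4
        have hru : u ≤ r := by
          by_contra hru
          have m1 := P.pos_mono' (r := u) (r' := r + 1) (v := a) (by omega) (by omega) hlt.1
          have m2 := P.pos_mono' (r := r) (r' := 0) (v := a) (by omega) (by omega) hlt.1
          rcases g1.2 with h | h <;> omega
        obtain ⟨d, d1, d2, d3, d4⟩ := ih (by omega)
        exact ⟨d, d1, d2, hac.path.trans' d3, d4⟩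
      · exact ⟨a, hua, hlt.1, Path.rfl', hg, hs, hau⟩
  exact key v hp huv

theorem bw {P : PipeDream n} (h : P.Red) (ha : P.Acyclic) {u v w : ℕ} (huv : u < v) (hvw : v < w)
    (hp : P.Path w u) : P.Path w v ∨ P.Path v u := by
  have key : ∀ k u, u + k = n → u < v → P.Path w u → P.Path w v ∨ P.Path v u := by
    intro k
    induction k using Nat.strong_induction_on with
    | _ k ih =>
      intro u hk huv hp
      obtain ⟨d, d1, d2, d3, d4, d5, d6⟩ := g2 h ha (by omega) hp
      have hw := (hp.lt (by omega)).1
      rcases lt_trichotomy v d with hvd | hvd | hvd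
      · rcases Nat.lt_or_gt_of_ne (P.pos_ne (r := u) (u := v) (v := d) (by omega) (by omega) (by omega) d2 (by omega)) with hpp | hpp
        · exact Or.inr ((h.f3 (by omega) hvd d2 hpp).trans' d6)
        · exact Or.inl (d3.trans' (h.f4 (Nat.zero_le _) (by omega) (by omega) (by omega) d2 hpp d5))
      · rw [hvd]; exact Or.inl d3
      · rcases ih (n - d) (by omega) d (by omega) hvd d3 with h1 | h1
        · exact Or.inl h1
        · exact Or.inr (h1.trans' d6)
  exact key (n - u) u (by have := (hp.lt (by omega)).1; omega) huv hp

end PipeDream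


section PermPart

variable {n : ℕ}

/-- rank of the value `k` in `π` -/
def rk (π : Equiv.Perm (Fin n)) (k : ℕ) : ℕ := if h : k < n then (π⁻¹ ⟨k, h⟩).val else 0

theorem rk_fin (π : Equiv.Perm (Fin n)) (i : Fin n) : rk π i.val = (π⁻¹ i).val := by
  simp [rk]

theorem rk_lt (π : Equiv.Perm (Fin n)) {k : ℕ} (h : k < n) : rk π k < n := by
  have := rk_fin π ⟨k, h⟩
  simp only at this
  rw [this]; exact Fin.is_lt _

theorem rk_inj (π : Equiv.Perm (Fin n)) {a b : ℕ} (ha : a < n) (hb : b < n)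
    (h : rk π a = rk π b) : a = b := by
  have h1 := rk_fin π ⟨a, ha⟩
  have h2 := rk_fin π ⟨b, hb⟩
  simp only at h1 h2
  rw [h1, h2] at h
  have := (π⁻¹).injective (Fin.ext h)
  exact congrArg Fin.val this

theorem rk_ext {π σ : Equiv.Perm (Fin n)} (h : ∀ k < n, rk π k = rk σ k) : π = σ := by
  apply inv_injective
  ext i
  rw [← rk_fin, ← rk_fin]; exact h _ i.2

theorem rk_apply (π : Equiv.Perm (Fin n)) (i : Fin n) : rk π (π i).val = i.val := by
  rw [rk_fin]; simp

theorem weakLE_iff (π σ : Equiv.Perm (Fin n)) : WeakLE π σ ↔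
    ∀ i j, i < j → j < n → rk π j < rk π i → rk σ j < rk σ i := by
  constructor
  · intro h i j hij hj hr
    have := h ⟨i, by omega⟩ ⟨j, hj⟩ hij (by
      have h1 := rk_fin π ⟨i, by omega⟩
      have h2 := rk_fin π ⟨j, hj⟩
      simp only at h1 h2
      rw [h1, h2] at hr; exact hr)
    have h1 := rk_fin σ ⟨i, by omega⟩
    have h2 := rk_fin σ ⟨j, hj⟩
    simp only at h1 h2
    rw [h1, h2]; exact this
  · intro h i j hij hr
    have := h i.val j.val hij j.2 (by rw [rk_fin, rk_fin]; exact hr)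
    rw [rk_fin, rk_fin] at this; exact this

theorem weakLE_rfl (π : Equiv.Perm (Fin n)) : WeakLE π π := fun _ _ _ h => h

theorem WeakLE.trans {π σ τ : Equiv.Perm (Fin n)} (h : WeakLE π σ) (h' : WeakLE σ τ) :
    WeakLE π τ := fun i j hij hp => h' i j hij (h i j hij hp)

theorem exists_perm_of_order (R : ℕ → ℕ → Prop)
    (htr : ∀ a b c, a < n → b < n → c < n → R a b → R b c → R a c)
    (hirr : ∀ a, a < n → ¬ R a a)
    (htot : ∀ a b, a < n → b < n → a ≠ b → R a b ∨ R b a) :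
    ∃ π : Equiv.Perm (Fin n), ∀ a b, a < n → b < n → (rk π a < rk π b ↔ R a b) := by
  classical
  let f : Fin n → ℕ := fun a => (Finset.univ.filter (fun b : Fin n => R b a)).card
  have hf : ∀ a b : Fin n, R a b → f a < f b := by
    intro a b hab
    apply Finset.card_lt_card
    rw [Finset.ssubset_iff_of_subset]
    · exact ⟨a, by simp [hab], by simp [hirr a a.2]⟩
    · intro c hc
      simp only [Finset.mem_filter, Finset.mem_univ, true_and] at hc ⊢
      exact htr _ _ _ c.2 a.2 b.2 hc hab
  have hlt : ∀ a : Fin n, f a < n := by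
    intro a
    have : f a < (Finset.univ : Finset (Fin n)).card := by
      apply Finset.card_lt_card
      rw [Finset.ssubset_iff_of_subset (Finset.subset_univ _)]
      exact ⟨a, by simp, by simp [hirr a a.2]⟩
    simpa using this
  let g : Fin n → Fin n := fun a => ⟨f a, hlt a⟩
  have hinj : Function.Injective g := by
    intro a b hab
    have hab' : f a = f b := congrArg Fin.val hab
    by_contra hne
    rcases htot a b a.2 b.2 (fun h => hne (Fin.ext h)) with h | h
    · have := hf a b h; omega
    · have := hf b a h; omega
  let e : Equiv.Perm (Fin n) := Equiv.ofBijective g (Finite.injective_iff_bijective.1 hinj)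
  refine ⟨e⁻¹, ?_⟩
  intro a b ha hb
  have h1 : ∀ c (hc : c < n), rk e⁻¹ c = f ⟨c, hc⟩ := by
    intro c hc
    have := rk_fin e⁻¹ ⟨c, hc⟩
    simp only at this
    rw [this, inv_inv]; rfl
  rw [h1 a ha, h1 b hb]
  constructor
  · intro h
    have hne : a ≠ b := by rintro rfl; omega
    rcases htot a b ha hb hne with h2 | h2
    · exact h2
    · have := hf ⟨b, hb⟩ ⟨a, ha⟩ h2; omega
  · intro h; exact hf ⟨a, ha⟩ ⟨b, hb⟩ h

theorem exists_perm_of_inv (I : ℕ → ℕ → Prop)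
    (htr : ∀ a b c, a < b → b < c → c < n → I a b → I b c → I a c)
    (hco : ∀ a b c, a < b → b < c → c < n → I a c → I a b ∨ I b c) :
    ∃ π : Equiv.Perm (Fin n), ∀ a b, a < b → b < n → (rk π b < rk π a ↔ I a b) := by
  obtain ⟨π, hπ⟩ := exists_perm_of_order (n := n)
    (fun a b => (a < b ∧ ¬ I a b) ∨ (b < a ∧ I b a))
    (by
      intro a b c ha hb hc h1 h2
      rcases h1 with ⟨h1, h1'⟩ | ⟨h1, h1'⟩ <;> rcases h2 with ⟨h2, h2'⟩ | ⟨h2, h2'⟩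
      · refine Or.inl ⟨by omega, fun h => ?_⟩
        rcases hco a b c h1 h2 hc h with h | h
        · exact h1' h
        · exact h2' h
      · rcases lt_trichotomy a c with h | h | h
        · exact Or.inl ⟨h, fun h3 => h1' (htr _ _ _ h h2 hb h3 h2')⟩
        · subst h; exact absurd h2' h1'
        · refine Or.inr ⟨h, ?_⟩
          rcases hco c a b h h1 hb h2' with h3 | h3
          · exact h3
          · exact absurd h3 h1'
      · rcases lt_trichotomy a c with h | h | h
        · exact Or.inl ⟨h, fun h3 => h2' (htr _ _ _ h1 h hc h1' h3)⟩
        · subst h; exact absurd h1' h2'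
        · refine Or.inr ⟨h, ?_⟩
          rcases hco b c a h2 h ha h1' with h3 | h3
          · exact absurd h3 h2'
          · exact h3
      · exact Or.inr ⟨by omega, htr _ _ _ h2 h1 ha h2' h1'⟩)
    (by intro a _ h; omega)
    (by
      intro a b ha hb hne
      rcases Nat.lt_or_gt_of_ne hne with h | h
      · by_cases h2 : I a b
        · exact Or.inr (Or.inr ⟨h, h2⟩)
        · exact Or.inl (Or.inl ⟨h, h2⟩)
      · by_cases h2 : I b a
        · exact Or.inl (Or.inr ⟨h, h2⟩)
        · exact Or.inr (Or.inl ⟨h, h2⟩))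
  refine ⟨π, fun a b hab hb => ?_⟩
  rw [hπ b a hb (by omega)]
  constructor
  · rintro (⟨h, _⟩ | ⟨_, h⟩)
    · omega
    · exact h
  · intro h; exact Or.inr ⟨hab, h⟩

theorem exists_weak_join (S : Equiv.Perm (Fin n) → Prop) :
    ∃ κ : Equiv.Perm (Fin n), (∀ π, S π → WeakLE π κ) ∧
      ∀ τ, (∀ π, S π → WeakLE π τ) → WeakLE κ τ := by
  let U : ℕ → ℕ → Prop := fun u v => u < v ∧ v < n ∧ ∃ π, S π ∧ rk π v < rk π u
  have hU : ∀ u v w, u < v → v < w → U u w → U u v ∨ U v w := by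
    rintro u v w huv hvw ⟨h1, h2, π, h3, h4⟩
    by_cases h : rk π v < rk π u
    · exact Or.inl ⟨huv, by omega, π, h3, h⟩
    · exact Or.inr ⟨hvw, h2, π, h3, by omega⟩
  have hlt : ∀ u w, Relation.TransGen U u w → u < w ∧ w < n := by
    intro u w h
    induction h with
    | single h => exact ⟨h.1, h.2.1⟩
    | tail h1 h2 ih => exact ⟨lt_trans ih.1 h2.1, h2.2.1⟩
  have hco : ∀ u w, Relation.TransGen U u w → ∀ v, u < v → v < w →
      Relation.TransGen U u v ∨ Relation.TransGen U v w := by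
    intro u w h
    induction h with
    | single h =>
      intro v h1 h2
      rcases hU _ _ _ h1 h2 h with h | h
      · exact Or.inl (.single h)
      · exact Or.inr (.single h)
    | @tail b c h1 h2 ih =>
      intro v hv1 hv2
      rcases lt_trichotomy v b with h | h | h
      · rcases ih v hv1 h with h3 | h3
        · exact Or.inl h3
        · exact Or.inr (.tail h3 h2)
      · subst h; exact Or.inl h1
      · rcases hU _ _ _ h hv2 h2 with h3 | h3
        · exact Or.inl (.tail h1 h3)
        · exact Or.inr (.single h3)
  obtain ⟨κ, hκ⟩ := exists_perm_of_inv (n := n) (Relation.TransGen U)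
    (fun a b c _ _ _ h1 h2 => h1.trans h2)
    (fun a b c h1 h2 _ h => hco a c h b h1 h2)
  refine ⟨κ, ?_, ?_⟩
  · intro π hπ
    rw [weakLE_iff]
    intro i j hij hj hr
    rw [hκ i j hij hj]
    exact .single ⟨hij, hj, π, hπ, hr⟩
  · intro τ hτ
    rw [weakLE_iff]
    intro i j hij hj hr
    rw [hκ i j hij hj] at hr
    clear hij hj
    induction hr with
    | single h =>
      obtain ⟨h1, h2, π, h3, h4⟩ := h
      exact (weakLE_iff π τ).1 (hτ π h3) _ _ h1 h2 h4
    | tail h1 h2 ih =>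
      obtain ⟨h1, h2, π, h3, h4⟩ := h2
      exact lt_trans ((weakLE_iff π τ).1 (hτ π h3) _ _ h1 h2 h4) ih

theorem exists_swap_rk (τ : Equiv.Perm (Fin n)) {i j : ℕ} (hi : i < n) (hj : j < n) :
    ∃ τ2 : Equiv.Perm (Fin n), rk τ2 i = rk τ j ∧ rk τ2 j = rk τ i ∧
      ∀ k, k ≠ i → k ≠ j → rk τ2 k = rk τ k := by
  refine ⟨Equiv.swap ⟨i, hi⟩ ⟨j, hj⟩ * τ, ?_, ?_, ?_⟩
  · simp [rk, hi, hj]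
  · simp [rk, hi, hj]
  · intro k h1 h2
    by_cases hk : k < n
    · have : Equiv.swap (⟨i, hi⟩ : Fin n) ⟨j, hj⟩ ⟨k, hk⟩ = ⟨k, hk⟩ :=
        Equiv.swap_apply_of_ne_of_ne (by simpa using h1) (by simpa using h2)
      simp [rk, hk, this]
    · simp [rk, hk]

theorem exists_descent {σ τ : Equiv.Perm (Fin n)} (h : WeakLE σ τ) (hne : σ ≠ τ) :
    ∃ i j, i < j ∧ j < n ∧ rk τ i = rk τ j + 1 ∧ ¬ rk σ j < rk σ i := by
  by_contra hcon
  push Not at hcon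
  apply hne
  rw [weakLE_iff] at h
  have hstep : ∀ a b : Fin n, a.val + 1 = b.val → σ⁻¹ (τ a) < σ⁻¹ (τ b) := by
    intro a b hab
    have ha := rk_apply τ a
    have hb := rk_apply τ b
    have h3 := rk_fin σ (τ a)
    have h4 := rk_fin σ (τ b)
    rw [Fin.lt_def, ← h3, ← h4]
    rcases lt_trichotomy (τ a).val (τ b).val with h1 | h1 | h1
    · by_contra hlt
      have hne2 : rk σ (τ a).val ≠ rk σ (τ b).val := by
        intro he; have := rk_inj σ (τ a).2 (τ b).2 he; omega
      have := h _ _ h1 (τ b).2 (by omega)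
      omega
    · rw [h1] at ha; omega
    · exact hcon _ _ h1 (τ a).2 (by omega)
  have hmono : StrictMono (fun a : Fin n => σ⁻¹ (τ a)) := by
    have key : ∀ k (a b : Fin n), a.val + k + 1 = b.val → σ⁻¹ (τ a) < σ⁻¹ (τ b) := by
      intro k
      induction k with
      | zero => intro a b hab; exact hstep a b (by omega)
      | succ k ih =>
        intro a b hab
        have hb := b.2
        exact lt_trans (ih a ⟨a.val + k + 1, by omega⟩ rfl) (hstep _ b (by simp; omega))
    intro a b hab
    have : a.val < b.val := hab
    exact key (b.val - a.val - 1) a b (by omega)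
  have hid : (fun a : Fin n => σ⁻¹ (τ a)) = id := by
    apply (StrictMono.range_inj hmono strictMono_id).1
    have : Function.Surjective (fun a : Fin n => σ⁻¹ (τ a)) := (σ⁻¹).surjective.comp τ.surjective
    rw [this.range_eq]; simp
  ext a
  have := congrFun hid a
  simp only [id] at this
  rw [Equiv.Perm.inv_eq_iff_eq] at this
  rw [this]

/-- number of inversions -/
def invs (τ : Equiv.Perm (Fin n)) : ℕ :=
  (Finset.univ.filter (fun p : Fin n × Fin n => p.1 < p.2 ∧ τ⁻¹ p.2 < τ⁻¹ p.1)).card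

theorem weak_chain {σ : Equiv.Perm (Fin n)} (p : Equiv.Perm (Fin n) → Prop)
    (step : ∀ (τ τ2 : Equiv.Perm (Fin n)) (i j : ℕ), p τ → i < j → j < n → rk τ i = rk τ j + 1 →
      rk τ2 i = rk τ j → rk τ2 j = rk τ i → (∀ k, k ≠ i → k ≠ j → rk τ2 k = rk τ k) → p τ2) :
    ∀ (τ : Equiv.Perm (Fin n)), WeakLE σ τ → p τ → p σ := by
  have key : ∀ N (τ : Equiv.Perm (Fin n)), invs τ = N → WeakLE σ τ → p τ → p σ := by
    intro N
    induction N using Nat.strong_induction_on with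
    | _ N ih =>
      intro τ hN hw hp
      by_cases hne : σ = τ
      · rw [hne]; exact hp
      obtain ⟨i, j, hij, hj, hr, hs⟩ := exists_descent hw hne
      obtain ⟨τ2, h1, h2, h3⟩ := exists_swap_rk τ (i := i) (j := j) (by omega) hj
      have hp2 := step τ τ2 i j hp hij hj hr h1 h2 h3
      have hw' := (weakLE_iff _ _).1 hw
      have hcase : ∀ u v, u < v → v < n → ((u = i ∧ v = j) ∨
          (rk τ v < rk τ u ↔ rk τ2 v < rk τ2 u)) := by
        intro u v huv hv
        have e1 := fun h => rk_inj τ (a := u) (b := i) (by omega) (by omega) h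
        have e2 := fun h => rk_inj τ (a := u) (b := j) (by omega) (by omega) h
        have e3 := fun h => rk_inj τ (a := v) (b := i) (by omega) (by omega) h
        have e4 := fun h => rk_inj τ (a := v) (b := j) (by omega) (by omega) h
        have kk : ∀ w, (w = i ∧ rk τ2 w = rk τ j ∧ rk τ w = rk τ i) ∨
            (w = j ∧ rk τ2 w = rk τ i ∧ rk τ w = rk τ j) ∨
            (w ≠ i ∧ w ≠ j ∧ rk τ2 w = rk τ w) := by
          intro w
          by_cases a1 : w = i
          · subst a1; exact Or.inl ⟨rfl, h1, rfl⟩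
          by_cases a2 : w = j
          · subst a2; exact Or.inr (Or.inl ⟨rfl, h2, rfl⟩)
          exact Or.inr (Or.inr ⟨a1, a2, h3 w a1 a2⟩)
        rcases kk u with k1 | k1 | k1 <;> rcases kk v with k2 | k2 | k2 <;> omega
      have hw2 : WeakLE σ τ2 := by
        rw [weakLE_iff]
        intro u v huv hv hrr
        rcases hcase u v huv hv with h | h
        · rw [h.1, h.2] at hrr; omega
        · exact h.1 (hw' u v huv hv hrr)
      refine ih (invs τ2) ?_ τ2 rfl hw2 hp2
      rw [← hN]
      apply Finset.card_lt_card
      rw [Finset.ssubset_iff_of_subset]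
      · refine ⟨(⟨i, by omega⟩, ⟨j, hj⟩), ?_, ?_⟩
        · simp only [Finset.mem_filter, Finset.mem_univ, true_and]
          refine ⟨hij, ?_⟩
          rw [Fin.lt_def, ← rk_fin, ← rk_fin]; simp only; omega
        · simp only [Finset.mem_filter, Finset.mem_univ, true_and, not_and]
          intro _
          rw [Fin.lt_def, ← rk_fin, ← rk_fin]; simp only; omega
      · rintro ⟨u, v⟩
        simp only [Finset.mem_filter, Finset.mem_univ, true_and]
        rintro ⟨huv, hr2⟩
        refine ⟨huv, ?_⟩
        rw [Fin.lt_def, ← rk_fin, ← rk_fin] at hr2 ⊢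
        rcases hcase u v huv v.2 with h | h
        · rw [h.1, h.2] at hr2 ⊢; omega
        · exact h.2 hr2
  intro τ
  exact key _ τ rfl

end PermPart

namespace PipeDream
variable {n : ℕ}

theorem linExt_iff (P : PipeDream n) (π : Equiv.Perm (Fin n)) :
    P.LinExt π ↔ ∀ i j, P.Arc i j → rk π i < rk π j := by
  constructor
  · intro h i j ha
    have hl := Arc.lt P ha
    have := h ⟨i, hl.1⟩ ⟨j, hl.2.1⟩ ha
    have h1 := rk_fin π ⟨i, hl.1⟩
    have h2 := rk_fin π ⟨j, hl.2.1⟩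
    simp only at h1 h2
    rw [h1, h2]; exact this
  · intro h i j ha
    have := h _ _ ha
    rw [rk_fin, rk_fin] at this; exact this

theorem LinExt.path {P : PipeDream n} {π : Equiv.Perm (Fin n)} (h : P.LinExt π) {i j : ℕ}
    (hp : P.Path i j) : rk π i ≤ rk π j := by
  rw [linExt_iff] at h
  unfold Path at hp
  induction hp with
  | refl => exact le_refl _
  | tail _ h2 ih => have := h _ _ h2; omega

theorem LinExt.acyclic {P : PipeDream n} {π : Equiv.Perm (Fin n)} (h : P.LinExt π) :
    P.Acyclic := by
  have h' := (linExt_iff P π).1 h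
  intro i hi
  obtain ⟨b, h1, h2⟩ := Relation.TransGen.head'_iff.1 hi
  have := h' _ _ h1
  have := h.path h2
  omega

theorem pos_zero {P : PipeDream n} {ω : Equiv.Perm (Fin n)} (h : P.HasExitPerm ω) {k : ℕ}
    (hk : k < n) : P.pos 0 k = rk ω k := by
  have h1 := h (ω⁻¹ ⟨k, hk⟩)
  rw [show ω (ω⁻¹ ⟨k, hk⟩) = ⟨k, hk⟩ from by simp] at h1
  have h2 := rk_fin ω ⟨k, hk⟩
  simp only at h2
  rw [h2]
  exact P.pos_eq (by have := (ω⁻¹ ⟨k, hk⟩).2; omega) h1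

theorem LinExt.weakLE {P : PipeDream n} {π ω : Equiv.Perm (Fin n)} (h : P.LinExt π) (hr : P.Red)
    (hω : P.HasExitPerm ω) : WeakLE π ω := by
  rw [weakLE_iff]
  intro i j hij hj hp
  by_contra hcon
  have hne := P.pos_ne (r := 0) (u := i) (v := j) (by omega) (by omega) (by omega) hj (by omega)
  rw [← pos_zero hω hj, ← pos_zero hω (by omega)] at hcon
  have := h.path (hr.f3 (Nat.zero_le i) hij hj (by omega))
  omega

theorem exists_min {P : PipeDream n} (hr : P.Red) (ha : P.Acyclic) :
    ∃ π, P.LinExt π ∧ ∀ u v, u < v → v < n → (rk π v < rk π u ↔ P.Path v u) := by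
  obtain ⟨π, hπ⟩ := exists_perm_of_inv (n := n) (fun u v => P.Path v u)
    (fun a b c _ _ _ h1 h2 => h2.trans' h1)
    (fun a b c h1 h2 _ h => (bw hr ha h1 h2 h).symm)
  refine ⟨π, ?_, hπ⟩
  rw [linExt_iff]
  intro i j hij
  have hl := Arc.lt P hij
  rcases Nat.lt_or_gt_of_ne hl.2.2 with h | h
  · by_contra hcon
    have hne : rk π i ≠ rk π j := fun he => hl.2.2 (rk_inj π hl.1 hl.2.1 he)
    have := (hπ i j h hl.2.1).1 (by omega)
    exact hl.2.2 (ha.antisymm hij.path this)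
  · exact (hπ j i h hl.1).2 hij.path

end PipeDream


namespace PipeDream

variable {n : ℕ}

theorem ext_cross {P Q : PipeDream n} (h : ∀ r c, P.cross r c = Q.cross r c) : P = Q := by
  cases P; cases Q
  congr
  funext r c
  exact h r c

theorem elbow_iff {P : PipeDream n} (h : P.Red) {π : Equiv.Perm (Fin n)} (hl : P.LinExt π)
    {r c : ℕ} (hin : r + c + 2 ≤ n) :
    P.cross r c = false ↔ (P.pos r r ≤ c ∧ ∀ c', c < c' → r + c' < n →
      rk π (P.up r c) < rk π (P.up r c')) := by
  have hr := P.run (P.active_self (r := r) (by omega))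
  constructor
  · intro hc
    have hle : P.pos r r ≤ c := by
      by_contra hlt
      have := (hr.2 c (by omega) (Or.inl rfl)).2 (by omega)
      rw [hc] at this; exact absurd this (by decide)
    refine ⟨hle, fun c' hcc hc' => ?_⟩
    have hup := P.up_elbow hc
    obtain ⟨a1, a2, a3⟩ := P.active_of_west (r := r) (c := c) (by omega) hup.symm
    have pv := P.pos_up (r := r) (c := c) (by omega)
    have pu := P.pos_up (r := r) (c := c') hc'
    have gv := P.up_ge (r := r) (c := c) (by omega)
    have gu := P.up_ge (r := r) (c := c') hc'
    have lv := P.up_lt (r := r) (c := c) (by omega)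
    have lu := P.up_lt (r := r) (c := c') hc'
    set v := P.up r c with hv
    set u := P.up r c' with hu
    have huv : u ≠ v := by intro he; rw [he] at pu; omega
    have hur : u ≠ r := by intro he; rw [he] at pu; omega
    have hpath : P.Path v u := by
      rcases Nat.lt_or_gt_of_ne huv with hlt | hlt
      · have hact : r < v ∧ P.pos (r + 1) v < P.pos r v := by
          rcases a1.2 with h | h
          · omega
          · exact h
        have hlt2 : P.pos (r + 1) v < P.pos (r + 1) u := by
          by_contra hcon
          have hne := P.pos_ne (r := r + 1) (u := u) (v := v) (by omega) lu (by omega) lv huv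
          have := P.pos_mono (r := r) (v := u) (by omega) lu
          have hcr := P.active_cross (r := r) (v := u) (u := v) ⟨lu, Or.inr ⟨by omega, by omega⟩⟩
            (by omega) lv (Or.inr (by omega)) (by omega)
          omega
        exact h.f4 (r := r + 1) (r' := r) (by omega) (by omega) lu (by omega) lv hlt2 (by omega)
      · exact h.f3 gv hlt lu (by omega)
    have h1 := hl.path hpath
    have h2 : rk π v ≠ rk π u := fun he => huv (rk_inj π lu lv he.symm)
    omega
  · rintro ⟨hle, hall⟩
    by_contra hcon
    have hc : P.cross r c = true := by simpa using hcon
    obtain ⟨a1, a2, a3, a4, a5, a6, a7⟩ := P.cross_data hc rfl rfl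
    have hlt := h _ _ hc
    have hs : P.up r c = P.south r c := by rw [P.up_cross hc, P.south_eq hin]
    have hir : P.west r c ≠ r := by intro he; rw [he] at a6; omega
    have hw : r ≤ P.west r c := by rcases a7 with h | h <;> omega
    have := hall (P.pos r (P.west r c)) a6 (P.pos_lt hw a1.1)
    rw [P.up_pos hw a1.1, hs] at this
    have := hl.path (h.f3 (r := r + 1) (by omega) hlt a2 (by omega))
    omega

theorem eq_of_common {P Q : PipeDream n} (hP : P.Red) (hQ : Q.Red) {ω π : Equiv.Perm (Fin n)}
    (hPω : P.HasExitPerm ω) (hQω : Q.HasExitPerm ω) (hPl : P.LinExt π) (hQl : Q.LinExt π) :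
    P = Q := by
  have hrow : ∀ r, (∀ c, r + c < n → P.up r c = Q.up r c) → ∀ c, P.cross r c = Q.cross r c := by
    intro r hr c
    by_cases hin : r + c + 2 ≤ n
    · have hpos : P.pos r r = Q.pos r r := by
        have h1 := P.pos_spec (r := r) (v := r) (le_refl _) (by omega)
        rw [hr _ h1.1] at h1
        exact (Q.pos_eq h1.1 h1.2).symm
      have e1 := elbow_iff hP hPl hin
      have e2 := elbow_iff hQ hQl hin
      have : P.cross r c = false ↔ Q.cross r c = false := by
        rw [e1, e2, hpos, hr c (by omega)]
        constructor
        · rintro ⟨h1, h2⟩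
          exact ⟨h1, fun c' h3 h4 => by rw [← hr c' h4]; exact h2 c' h3 h4⟩
        · rintro ⟨h1, h2⟩
          exact ⟨h1, fun c' h3 h4 => by rw [hr c' h4]; exact h2 c' h3 h4⟩
      cases h1 : P.cross r c <;> cases h2 : Q.cross r c <;> simp_all
    · rw [P.cross_false (by omega), Q.cross_false (by omega)]
  have hup : ∀ r, ∀ c, r + c < n → P.up r c = Q.up r c := by
    intro r
    induction r with
    | zero =>
      intro c hc
      have h1 := hPω ⟨c, by omega⟩
      have h2 := hQω ⟨c, by omega⟩
      exact h1.trans h2.symm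
    | succ r ih =>
      have hcr := hrow r ih
      have hw : ∀ k c, r + c + k + 1 = n → P.west r c = Q.west r c := by
        intro k
        induction k with
        | zero =>
          intro c hc
          rw [← P.up_elbow (P.cross_false (by omega)), ← Q.up_elbow (Q.cross_false (by omega))]
          exact ih c (by omega)
        | succ k ihk =>
          intro c hc
          cases h : P.cross r c with
          | false =>
            rw [← P.up_elbow h, ← Q.up_elbow ((hcr c) ▸ h)]
            exact ih c (by omega)
          | true =>
            rw [← P.west_cross h, ← Q.west_cross ((hcr c) ▸ h)]
            exact ihk (c + 1) (by omega)
      intro c hc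
      cases h : P.cross r c with
      | false =>
        rw [← P.west_elbow h (by omega), ← Q.west_elbow ((hcr c) ▸ h) (by omega)]
        exact hw (n - 1 - r - (c + 1)) _ (by omega)
      | true =>
        rw [← P.up_cross h, ← Q.up_cross ((hcr c) ▸ h)]
        exact ih c (by omega)
  exact ext_cross (fun r => hrow r (hup r))

/-- number of labels `≥ r` that come before `v` in `ω` -/
def cnt (ω : Equiv.Perm (Fin n)) (r v : ℕ) : ℕ :=
  ((Finset.Ico r n).filter (fun k => rk ω k < rk ω v)).card

theorem cnt_mono (ω : Equiv.Perm (Fin n)) {r u v : ℕ} (hu : r ≤ u) (hun : u < n)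
    (h : rk ω u < rk ω v) : cnt ω r u < cnt ω r v := by
  apply Finset.card_lt_card
  rw [Finset.ssubset_iff_of_subset]
  · exact ⟨u, by simp [hu, hun, h], by simp⟩
  · intro k hk
    simp only [Finset.mem_filter] at hk ⊢
    exact ⟨hk.1, by omega⟩

theorem cnt_lt (ω : Equiv.Perm (Fin n)) {r v : ℕ} (hv : r ≤ v) (hvn : v < n) :
    r + cnt ω r v < n := by
  have : cnt ω r v < (Finset.Ico r n).card := by
    apply Finset.card_lt_card
    rw [Finset.ssubset_iff_of_subset (Finset.filter_subset _ _)]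
    exact ⟨v, by simp [hv, hvn], by simp⟩
  simp at this; omega

theorem cnt_succ (ω : Equiv.Perm (Fin n)) {r : ℕ} (v : ℕ) (hr : r < n) :
    cnt ω r v = cnt ω (r + 1) v + if rk ω r < rk ω v then 1 else 0 := by
  unfold cnt
  have : Finset.Ico r n = insert r (Finset.Ico (r + 1) n) := by
    ext k; simp; omega
  rw [this, Finset.filter_insert]
  split_ifs with h
  · rw [Finset.card_insert_of_notMem (by simp)]
  · rfl

theorem cnt_zero (ω : Equiv.Perm (Fin n)) {v : ℕ} (hv : v < n) : cnt ω 0 v = rk ω v := by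
  unfold cnt
  have h1 : ((Finset.Ico 0 n).filter (fun k => rk ω k < rk ω v)).image (rk ω)
      = Finset.range (rk ω v) := by
    ext m
    simp only [Finset.mem_image, Finset.mem_filter, Finset.mem_Ico, Finset.mem_range]
    constructor
    · rintro ⟨k, ⟨_, h⟩, rfl⟩; exact h
    · intro hm
      have hmn : m < n := by have := rk_lt ω hv; omega
      have := rk_apply ω ⟨m, hmn⟩
      simp only at this
      exact ⟨(ω ⟨m, hmn⟩).val, ⟨⟨by omega, (ω ⟨m, hmn⟩).2⟩, by omega⟩, this⟩
  have h2 := congrArg Finset.card h1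
  rw [Finset.card_range, Finset.card_image_of_injOn] at h2
  · exact h2
  intro a ha b hb he
  simp at ha hb
  exact rk_inj ω ha.1 hb.1 he

theorem exists_top (ω : Equiv.Perm (Fin n)) : ∃ P : PipeDream n, P.Red ∧ P.HasExitPerm ω ∧
    P.LinExt ω := by
  let P : PipeDream n := ⟨fun r c => decide (r < n ∧ c < cnt ω r r), by
    intro r c h
    simp only [decide_eq_true_eq] at h
    have h1 := cnt_succ ω r h.1
    simp at h1
    have h2 : cnt ω (r + 1) r ≤ (Finset.Ico (r + 1) n).card :=
      Finset.card_le_card (Finset.filter_subset _ _)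
    simp at h2
    omega⟩
  have hcT : ∀ r c, r < n → c < cnt ω r r → P.cross r c = true := by
    intro r c h1 h2; simp [P, h1, h2]
  have hcF : ∀ r c, cnt ω r r ≤ c → P.cross r c = false := by
    intro r c h1; simp [P]; intro; omega
  have hwest : ∀ r c, r < n → c ≤ cnt ω r r → P.west r c = r := by
    intro r c hr
    induction c with
    | zero => intro _; exact P.west_zero r
    | succ c ih => intro h; rw [P.west_cross (hcT r c hr (by omega))]; exact ih (by omega)
  have hup : ∀ k r, r + k = n → ∀ v, r ≤ v → v < n → P.up r (cnt ω r v) = v := by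
    intro k
    induction k with
    | zero => intros; omega
    | succ k ih =>
      intro r hr v hv hvn
      have hsr := cnt_succ ω r (r := r) (by omega)
      simp at hsr
      by_cases hvr : v = r
      · subst hvr
        rw [P.up_elbow (hcF _ _ (le_refl _))]
        exact hwest v _ hvn (le_refl _)
      · have hI := ih (r + 1) (by omega) v (by omega) hvn
        have hlt := cnt_lt ω (r := r + 1) (v := v) (by omega) hvn
        have hs := cnt_succ ω v (r := r) (by omega)
        rcases lt_trichotomy (rk ω v) (rk ω r) with h | h | h
        · have h2 := cnt_mono ω (r := r) hv hvn h
          rw [P.up_cross (hcT r _ (by omega) h2), hs, if_neg (by omega)]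
          exact hI
        · exact absurd (rk_inj ω hvn (by omega) h) hvr
        · rw [if_pos h] at hs
          have h2 := cnt_mono ω (r := r) (le_refl _) (by omega) h
          rw [P.up_elbow (hcF r _ (by omega)), hs, P.west_elbow (hcF r _ (by omega)) (by omega)]
          exact hI
  have hpos : ∀ r v, r ≤ v → v < n → P.pos r v = cnt ω r v := by
    intro r v hr hv
    exact P.pos_eq (cnt_lt ω hr hv) (hup (n - r) r (by omega) v hr hv)
  refine ⟨P, ?_, ?_, ?_⟩
  · intro r c hc
    have h1 : r < n ∧ c < cnt ω r r := by simpa [P] using hc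
    rw [hwest r c h1.1 (by omega)]
    exact (P.cross_data hc rfl rfl).2.2.1
  · intro c
    have h1 := hup n 0 (by omega) (ω c).val (by omega) (ω c).2
    rw [cnt_zero ω (ω c).2, rk_apply] at h1
    exact h1
  · rw [linExt_iff]
    rintro i j ⟨r, c, h1, h2, h3, h4⟩
    obtain ⟨a1, a2, a3, a4, a5, a6, a7⟩ := P.arc_data h1 h2 h3 h4
    have hri : r ≤ i := by omega
    rw [hpos r i hri a1.1] at a4
    rw [hpos r j (by omega) a2.1] at a6
    by_contra hcon
    have hne : rk ω i ≠ rk ω j := by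
      intro he
      have := rk_inj ω a1.1 a2.1 he
      subst this; omega
    have := cnt_mono ω (r := r) (u := j) (v := i) (by omega) a2.1 (by omega)
    omega

end PipeDream


namespace PipeDream

variable {n : ℕ}

theorem row_seg (P Q : PipeDream n) (f : ℕ → ℕ) (r c0 c1 : ℕ)
    (h0 : Q.west r c0 = f (P.west r c0))
    (h1 : ∀ c, c0 ≤ c → c < c1 → r + c + 2 ≤ n → Q.up (r + 1) c = f (P.up (r + 1) c))
    (h2 : ∀ c, c0 ≤ c → c < c1 → Q.cross r c = P.cross r c) :
    ∀ c, c0 ≤ c → c ≤ c1 → r + c < n → Q.west r c = f (P.west r c) ∧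
      (c < c1 → Q.up r c = f (P.up r c)) := by
  have hw : ∀ k, c0 + k ≤ c1 → r + (c0 + k) < n → Q.west r (c0 + k) = f (P.west r (c0 + k)) := by
    intro k
    induction k with
    | zero => intro _ _; exact h0
    | succ k ih =>
      intro hk hn
      have hq := h2 (c0 + k) (by omega) (by omega)
      rw [← Nat.add_assoc]
      cases h : P.cross r (c0 + k) with
      | false =>
        rw [P.west_elbow h (by omega), Q.west_elbow (hq.trans h) (by omega)]
        exact h1 _ (by omega) (by omega) (by omega)
      | true =>
        rw [P.west_cross h, Q.west_cross (hq.trans h)]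
        exact ih (by omega) (by omega)
  intro c hc0 hc1 hn
  have hwc : Q.west r c = f (P.west r c) := by
    have := hw (c - c0) (by omega) (by omega)
    rwa [show c0 + (c - c0) = c by omega] at this
  refine ⟨hwc, fun hlt => ?_⟩
  have hq := h2 c hc0 hlt
  cases h : P.cross r c with
  | false => rw [P.up_elbow h, Q.up_elbow (hq.trans h)]; exact hwc
  | true =>
    rw [P.up_cross h, Q.up_cross (hq.trans h)]
    exact h1 _ hc0 hlt (P.inShape _ _ h)

theorem box_facts (P : PipeDream n) {r c x y : ℕ} (hin : r + c + 2 ≤ n) (hw : P.west r c = x)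
    (hs : P.south r c = y) : r ≤ x ∧ r < y ∧ x < n ∧ y < n ∧ x ≠ y ∧ P.pos (r + 1) y = c ∧
    (∀ c', c' < c → P.up r c' ≠ x ∧ P.up r c' ≠ y) ∧
    (∀ c', c < c' → r + c' + 2 ≤ n → P.up (r + 1) c' ≠ x ∧ P.up (r + 1) c' ≠ y) := by
  obtain ⟨a1, a2, a3⟩ := P.active_of_west (r := r) (c := c) (by omega) hw
  rw [P.south_eq hin] at hs
  have g1 := P.up_ge (r := r + 1) (c := c) (by omega)
  have g2 := P.up_lt (r := r + 1) (c := c) (by omega)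
  have g3 : P.pos (r + 1) y = c := P.pos_eq (by omega) hs
  have g4 := P.pos_mono (r := r) (v := y) (by omega) (by omega)
  refine ⟨by omega, by omega, a1.1, by omega, ?_, g3, ?_, ?_⟩
  · rintro rfl; omega
  · intro c' hc'
    constructor
    · intro he
      have := P.pos_eq (by omega) he
      omega
    · intro he
      have := P.pos_eq (by omega) he
      omega
  · intro c' hc' hn
    have g5 := P.up_ge (r := r + 1) (c := c') (by omega)
    constructor
    · intro he
      have := P.pos_eq (by omega) he
      omega
    · intro he
      have := P.pos_eq (by omega) he
      omega

/-- `P` and `Q` differ exactly at two boxes `(ρ, γ)`, `(R, γ')` where the same two pipes meet -/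
structure FlipData (P Q : PipeDream n) (ρ γ R γ' x y : ℕ) : Prop where
  hR : R < ρ
  hin : ρ + γ + 2 ≤ n
  hin' : R + γ' + 2 ≤ n
  hoth : ∀ r c, ¬ (r = ρ ∧ c = γ) → ¬ (r = R ∧ c = γ') → Q.cross r c = P.cross r c
  hb : Q.cross ρ γ = !P.cross ρ γ
  hb' : Q.cross R γ' = !P.cross R γ'
  hw : P.west ρ γ = x
  hs : P.south ρ γ = y
  hws : (P.west R γ' = x ∧ P.south R γ' = y) ∨ (P.west R γ' = y ∧ P.south R γ' = x)

/-- the region where the labels are exchanged -/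
def Zone (ρ γ R γ' r c : ℕ) : Prop := (R < r ∧ r < ρ) ∨ (r = ρ ∧ γ < c) ∨ (r = R ∧ c ≤ γ')

section
variable {P Q : PipeDream n} {ρ γ R γ' x y : ℕ}

theorem swap_ne {x y v : ℕ} (h1 : v ≠ x) (h2 : v ≠ y) : Equiv.swap x y v = v :=
  Equiv.swap_apply_of_ne_of_ne h1 h2

theorem FlipData.rowρ (D : FlipData P Q ρ γ R γ' x y)
    (h1 : ∀ c, ρ + c + 2 ≤ n → Q.up (ρ + 1) c = P.up (ρ + 1) c) : ∀ c, ρ + c < n →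
    (c ≤ γ → Q.west ρ c = P.west ρ c) ∧ (γ < c → Q.west ρ c = Equiv.swap x y (P.west ρ c)) ∧
    Q.up ρ c = Equiv.swap x y (P.up ρ c) := by
  obtain ⟨b1, b2, b3, b4, b5, b6, b7, b8⟩ := P.box_facts D.hin D.hw D.hs
  have hin := D.hin
  have hR := D.hR
  have s1 := row_seg P Q id ρ 0 γ (by simp [west_zero]) (fun c _ _ h => h1 c h)
    (fun c _ hc => D.hoth _ _ (by omega) (by omega))
  have wγ := (s1 γ (by omega) (le_refl _) (by omega)).1
  simp only [id] at wγ s1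
  have hS : P.up (ρ + 1) γ = y := by rw [← P.south_eq hin]; exact D.hs
  have hSQ : Q.up (ρ + 1) γ = y := by rw [h1 γ hin]; exact hS
  have hWQ : Q.west ρ γ = x := wγ.trans D.hw
  have wγ1 : Q.west ρ (γ + 1) = Equiv.swap x y (P.west ρ (γ + 1)) ∧
      Q.up ρ γ = Equiv.swap x y (P.up ρ γ) := by
    cases h : P.cross ρ γ with
    | false =>
      have h' : Q.cross ρ γ = true := by rw [D.hb, h]; rfl
      rw [P.west_elbow h hin, Q.west_cross h', P.up_elbow h, Q.up_cross h', hS, hSQ, hWQ, D.hw]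
      simp
    | true =>
      have h' : Q.cross ρ γ = false := by rw [D.hb, h]; rfl
      rw [Q.west_elbow h' hin, P.west_cross h, Q.up_elbow h', P.up_cross h, hS, hSQ, hWQ, D.hw]
      simp
  have s2 := row_seg P Q (Equiv.swap x y) ρ (γ + 1) n wγ1.1
    (fun c hc _ h => by
      rw [h1 c h, swap_ne (b8 c (by omega) h).1 (b8 c (by omega) h).2])
    (fun c hc _ => D.hoth _ _ (by omega) (by omega))
  intro c hc
  refine ⟨fun h => (s1 c (by omega) h hc).1, fun h => (s2 c (by omega) (by omega) hc).1, ?_⟩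
  rcases lt_trichotomy c γ with h | h | h
  · rw [(s1 c (by omega) (by omega) hc).2 h, swap_ne (b7 c h).1 (b7 c h).2]
  · subst h; exact wγ1.2
  · exact (s2 c (by omega) (by omega) hc).2 (by omega)

theorem FlipData.bounds (D : FlipData P Q ρ γ R γ' x y) : ρ ≤ x ∧ ρ < y ∧ x < n ∧ y < n ∧ x ≠ y := by
  obtain ⟨b1, b2, b3, b4, b5, b6, b7, b8⟩ := P.box_facts D.hin D.hw D.hs
  exact ⟨b1, b2, b3, b4, b5⟩

theorem FlipData.rowR (D : FlipData P Q ρ γ R γ' x y)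
    (h1 : ∀ c, R + c + 2 ≤ n → Q.up (R + 1) c = Equiv.swap x y (P.up (R + 1) c)) :
    ∀ c, R + c < n →
    (c ≤ γ' → Q.west R c = Equiv.swap x y (P.west R c)) ∧ (γ' < c → Q.west R c = P.west R c) ∧
    Q.up R c = P.up R c := by
  have hin := D.hin'
  have hR := D.hR
  obtain ⟨d1, d2, d3, d4, d5⟩ := D.bounds
  have hbx : (∀ c', c' < γ' → P.up R c' ≠ x ∧ P.up R c' ≠ y) ∧
    (∀ c', γ' < c' → R + c' + 2 ≤ n → P.up (R + 1) c' ≠ x ∧ P.up (R + 1) c' ≠ y) := by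
    rcases D.hws with ⟨e1, e2⟩ | ⟨e1, e2⟩
    · obtain ⟨b1, b2, b3, b4, b5, b6, b7, b8⟩ := P.box_facts hin e1 e2
      exact ⟨b7, b8⟩
    · obtain ⟨b1, b2, b3, b4, b5, b6, b7, b8⟩ := P.box_facts hin e1 e2
      exact ⟨fun c h => (b7 c h).symm, fun c h h' => (b8 c h h').symm⟩
  have s1 := row_seg P Q (Equiv.swap x y) R 0 γ'
    (by rw [west_zero, west_zero, swap_ne] <;> omega) (fun c _ _ h => h1 c h)
    (fun c _ hc => D.hoth _ _ (by omega) (by omega))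
  have wγ := (s1 γ' (by omega) (le_refl _) (by omega)).1
  have hQS : Q.up (R + 1) γ' = P.west R γ' := by
    rw [h1 γ' hin, ← P.south_eq hin]
    rcases D.hws with ⟨e1, e2⟩ | ⟨e1, e2⟩ <;> rw [e1, e2] <;> simp
  have hQW : Q.west R γ' = P.up (R + 1) γ' := by
    rw [wγ, ← P.south_eq hin]
    rcases D.hws with ⟨e1, e2⟩ | ⟨e1, e2⟩ <;> rw [e1, e2] <;> simp
  have wγ1 : Q.west R (γ' + 1) = P.west R (γ' + 1) ∧ Q.up R γ' = P.up R γ' := by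
    cases h : P.cross R γ' with
    | false =>
      have h' : Q.cross R γ' = true := by rw [D.hb', h]; rfl
      rw [P.west_elbow h hin, Q.west_cross h', P.up_elbow h, Q.up_cross h']
      exact ⟨hQW, hQS⟩
    | true =>
      have h' : Q.cross R γ' = false := by rw [D.hb', h]; rfl
      rw [Q.west_elbow h' hin, P.west_cross h, Q.up_elbow h', P.up_cross h]
      exact ⟨hQS, hQW⟩
  have s2 := row_seg P Q id R (γ' + 1) n wγ1.1
    (fun c hc _ h => by
      rw [h1 c h, swap_ne (hbx.2 c (by omega) h).1 (hbx.2 c (by omega) h).2]; rfl)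
    (fun c hc _ => D.hoth _ _ (by omega) (by omega))
  simp only [id] at s2
  intro c hc
  refine ⟨fun h => (s1 c (by omega) h hc).1, fun h => (s2 c (by omega) (by omega) hc).1, ?_⟩
  rcases lt_trichotomy c γ' with h | h | h
  · rw [(s1 c (by omega) (by omega) hc).2 h, swap_ne (hbx.1 c h).1 (hbx.1 c h).2]
  · subst h; exact wγ1.2
  · exact (s2 c (by omega) (by omega) hc).2 (by omega)

theorem FlipData.main (D : FlipData P Q ρ γ R γ' x y) : ∀ k r, r + k = n →
    (∀ c, r + c < n → (Zone ρ γ R γ' r c → Q.west r c = Equiv.swap x y (P.west r c)) ∧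
      (¬ Zone ρ γ R γ' r c → Q.west r c = P.west r c) ∧
      (R < r → r ≤ ρ → Q.up r c = Equiv.swap x y (P.up r c)) ∧
      (¬ (R < r ∧ r ≤ ρ) → Q.up r c = P.up r c)) := by
  have hR := D.hR
  have hin := D.hin
  have hin' := D.hin'
  obtain ⟨d1, d2, d3, d4, d5⟩ := D.bounds
  intro k
  induction k with
  | zero => intros; omega
  | succ k ih =>
    intro r hr
    have IH := ih (r + 1) (by omega)
    by_cases h1 : r = ρ
    · subst h1
      have := D.rowρ (fun c hc => (IH c (by omega)).2.2.2 (by omega))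
      intro c hc
      refine ⟨fun h => (this c hc).2.1 ?_, fun h => (this c hc).1 ?_, fun _ _ => (this c hc).2.2,
        fun h => absurd ⟨hR, le_refl _⟩ h⟩
      · unfold Zone at h; omega
      · unfold Zone at h; omega
    by_cases h2 : r = R
    · subst h2
      have := D.rowR (fun c hc => (IH c (by omega)).2.2.1 (by omega) (by omega))
      intro c hc
      refine ⟨fun h => (this c hc).1 ?_, fun h => (this c hc).2.1 ?_, fun h => absurd h (by omega),
        fun h => (this c hc).2.2⟩
      · unfold Zone at h; omega
      · unfold Zone at h; omega
    by_cases h3 : R < r ∧ r < ρ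
    · have s1 := row_seg P Q (Equiv.swap x y) r 0 n
        (by rw [west_zero, west_zero, swap_ne] <;> omega)
        (fun c _ _ h => (IH c (by omega)).2.2.1 (by omega) (by omega))
        (fun c _ hc => D.hoth _ _ (by omega) (by omega))
      intro c hc
      have := s1 c (by omega) (by omega) hc
      exact ⟨fun _ => this.1, fun h => absurd (Or.inl h3) h, fun _ _ => this.2 (by omega),
        fun h => absurd h (by omega)⟩
    · have s1 := row_seg P Q id r 0 n
        (by rw [west_zero, west_zero]; rfl)
        (fun c _ _ h => (IH c (by omega)).2.2.2 (by omega))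
        (fun c _ hc => D.hoth _ _ (by omega) (by omega))
      intro c hc
      have := s1 c (by omega) (by omega) hc
      exact ⟨fun h => by unfold Zone at h; omega, fun _ => this.1, fun h1 h2 => by omega,
        fun _ => this.2 (by omega)⟩

theorem FlipData.west_zone (D : FlipData P Q ρ γ R γ' x y) {r c : ℕ} (hn : r + c < n)
    (h : Zone ρ γ R γ' r c) : Q.west r c = Equiv.swap x y (P.west r c) :=
  (D.main (n - r) r (by omega) c hn).1 h

theorem FlipData.west_nzone (D : FlipData P Q ρ γ R γ' x y) {r c : ℕ} (hn : r + c < n)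
    (h : ¬ Zone ρ γ R γ' r c) : Q.west r c = P.west r c :=
  (D.main (n - r) r (by omega) c hn).2.1 h

theorem FlipData.up_in (D : FlipData P Q ρ γ R γ' x y) {r c : ℕ} (hn : r + c < n)
    (h1 : R < r) (h2 : r ≤ ρ) : Q.up r c = Equiv.swap x y (P.up r c) :=
  (D.main (n - r) r (by omega) c hn).2.2.1 h1 h2

theorem FlipData.up_out (D : FlipData P Q ρ γ R γ' x y) {r c : ℕ} (hn : r + c < n)
    (h : ¬ (R < r ∧ r ≤ ρ)) : Q.up r c = P.up r c :=
  (D.main (n - r) r (by omega) c hn).2.2.2 h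

theorem FlipData.south_zone (D : FlipData P Q ρ γ R γ' x y) {r c : ℕ} (hn : r + c + 2 ≤ n)
    (h : Zone ρ γ R γ' r c) : Q.south r c = Equiv.swap x y (P.south r c) := by
  have hR := D.hR
  rw [P.south_eq hn, Q.south_eq hn]
  by_cases h1 : r = ρ
  · rw [D.up_out (by omega) (by omega)]
    obtain ⟨b1, b2, b3, b4, b5, b6, b7, b8⟩ := P.box_facts D.hin D.hw D.hs
    subst h1
    have := b8 c (by unfold Zone at h; omega) hn
    rw [swap_ne this.1 this.2]
  · unfold Zone at h
    rw [D.up_in (by omega) (by omega) (by omega)]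

theorem FlipData.south_nzone (D : FlipData P Q ρ γ R γ' x y) {r c : ℕ} (hn : r + c + 2 ≤ n)
    (h : ¬ Zone ρ γ R γ' r c) : Q.south r c = P.south r c := by
  have hR := D.hR
  rw [P.south_eq hn, Q.south_eq hn]
  by_cases h1 : r = R
  · subst h1
    rw [D.up_in (by omega) (by omega) (by omega)]
    have hc : γ' < c := by unfold Zone at h; omega
    rcases D.hws with ⟨e1, e2⟩ | ⟨e1, e2⟩
    · obtain ⟨b1, b2, b3, b4, b5, b6, b7, b8⟩ := P.box_facts D.hin' e1 e2
      have := b8 c hc hn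
      rw [swap_ne this.1 this.2]
    · obtain ⟨b1, b2, b3, b4, b5, b6, b7, b8⟩ := P.box_facts D.hin' e1 e2
      have := b8 c hc hn
      rw [swap_ne this.2 this.1]
  · unfold Zone at h
    rw [D.up_out (by omega) (by omega)]

theorem FlipData.pos_out (D : FlipData P Q ρ γ R γ' x y) {r v : ℕ} (hr : r ≤ v) (hv : v < n)
    (h : ¬ (R < r ∧ r ≤ ρ)) : Q.pos r v = P.pos r v := by
  have h1 := P.pos_spec hr hv
  exact Q.pos_eq h1.1 (by rw [D.up_out h1.1 h]; exact h1.2)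

theorem FlipData.pos_in (D : FlipData P Q ρ γ R γ' x y) {r v : ℕ} (hr : r ≤ v) (hv : v < n)
    (h1 : R < r) (h2 : r ≤ ρ) (hx : v ≠ x) (hy : v ≠ y) : Q.pos r v = P.pos r v := by
  have h3 := P.pos_spec hr hv
  exact Q.pos_eq h3.1 (by rw [D.up_in h3.1 h1 h2, h3.2, swap_ne hx hy])

theorem FlipData.pos_in_x (D : FlipData P Q ρ γ R γ' x y) {r : ℕ}
    (h1 : R < r) (h2 : r ≤ ρ) : Q.pos r x = P.pos r y := by
  obtain ⟨d1, d2, d3, d4, d5⟩ := D.bounds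
  have h3 := P.pos_spec (r := r) (v := y) (by omega) d4
  exact Q.pos_eq h3.1 (by rw [D.up_in h3.1 h1 h2, h3.2]; simp)

theorem FlipData.pos_in_y (D : FlipData P Q ρ γ R γ' x y) {r : ℕ}
    (h1 : R < r) (h2 : r ≤ ρ) : Q.pos r y = P.pos r x := by
  obtain ⟨d1, d2, d3, d4, d5⟩ := D.bounds
  have h3 := P.pos_spec (r := r) (v := x) (by omega) d3
  exact Q.pos_eq h3.1 (by rw [D.up_in h3.1 h1 h2, h3.2]; simp)

theorem FlipData.hasExit (D : FlipData P Q ρ γ R γ' x y) {ω : Equiv.Perm (Fin n)}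
    (h : P.HasExitPerm ω) : Q.HasExitPerm ω := by
  intro c
  rw [← h c]
  exact D.up_out (r := 0) (by omega) (by omega)

end

end PipeDream


namespace PipeDream

variable {n : ℕ}

/-- full data of an increasing flip between acyclic reduced pipe dreams -/
structure FL (P P' : PipeDream n) (i j γ R γ' : ℕ) : Prop where
  D : FlipData P P' i γ R γ' i j
  rP : P.Red
  rP' : P'.Red
  aP : P.Acyclic
  aP' : P'.Acyclic
  hij : i < j
  c1 : P.cross i γ = false
  c2 : P.cross R γ' = true
  w : P.west R γ' = i
  s : P.south R γ' = j

theorem IncFlip.fl {P P' : PipeDream n} (h : P.IncFlip P') (rP : P.Red) (rP' : P'.Red)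
    (aP : P.Acyclic) (aP' : P'.Acyclic) : ∃ i j γ R γ', FL P P' i j γ R γ' := by
  obtain ⟨⟨ρ, γ⟩, ⟨R, γ'⟩, ⟨hne, c1, c2, c3, c4, hoth, hlab⟩, hle1, hle2⟩ := h
  simp only at *
  have hin := P'.inShape _ _ c3
  have hin' := P.inShape _ _ c2
  obtain ⟨b1, b2, b3, b4, b5, b6, b7, b8⟩ := P.box_facts hin rfl rfl
  have hlab' : (P.west R γ' = P.west ρ γ ∧ P.south R γ' = P.south ρ γ) ∨
      (P.west R γ' = P.south ρ γ ∧ P.south R γ' = P.west ρ γ) := by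
    rcases hlab with ⟨e1, e2⟩ | ⟨e1, e2⟩
    · exact Or.inl ⟨e1.symm, e2.symm⟩
    · exact Or.inr ⟨e2.symm, e1.symm⟩
  have hR : R < ρ := by
    rcases Nat.lt_or_eq_of_le hle1 with h | h
    · exact h
    · exfalso
      subst h
      have hlt : γ < γ' := by
        rcases Nat.lt_or_eq_of_le hle2 with h | h
        · exact h
        · exact absurd (by rw [h]) hne
      have := b8 γ' hlt hin'
      rw [← P.south_eq hin'] at this
      rcases hlab' with ⟨e1, e2⟩ | ⟨e1, e2⟩
      · exact this.2 e2
      · exact this.1 e2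
  have D : FlipData P P' ρ γ R γ' (P.west ρ γ) (P.south ρ γ) :=
    { hR := hR, hin := hin, hin' := hin'
      hoth := by
        intro r c h1 h2
        refine (hoth r c ?_ ?_).symm
        · intro he; rw [Prod.mk.injEq] at he; exact h1 he
        · intro he; rw [Prod.mk.injEq] at he; exact h2 he
      hb := by rw [c1, c3]; rfl
      hb' := by rw [c2, c4]; rfl
      hw := rfl, hs := rfl, hws := hlab' }
  have hnz : ¬ Zone ρ γ R γ' ρ γ := by unfold Zone; omega
  have w' := D.west_nzone (by omega) hnz
  have s' := D.south_nzone hin hnz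
  have hlt := rP' _ _ c3
  rw [w', s'] at hlt
  have hlt2 := rP _ _ c2
  have hws : P.west R γ' = P.west ρ γ ∧ P.south R γ' = P.south ρ γ := by
    rcases hlab' with h | h
    · exact h
    · omega
  have hz : Zone ρ γ R γ' R γ' := Or.inr (Or.inr ⟨rfl, le_refl _⟩)
  have w2 := D.west_zone (by omega) hz
  have s2 := D.south_zone hin' hz
  rw [hws.1] at w2
  rw [hws.2] at s2
  simp only [Equiv.swap_apply_left, Equiv.swap_apply_right] at w2 s2
  have arc' : P'.Arc (P.south ρ γ) (P.west ρ γ) := ⟨R, γ', hin', c4, w2, s2⟩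
  have g := g1 rP' aP' hlt arc'.path
  obtain ⟨e1, e2, e3, e4, e5, e6, e7⟩ := P'.cross_data c3 w' s'
  have hi : P.west ρ γ = ρ := by
    rcases e7 with h | ⟨h, h2⟩
    · exact h
    · have := rP'.persist hlt e2 (r := P.west ρ γ) (r' := ρ + 1) (le_refl _) g (by omega)
      omega
  rw [hi] at D hlt
  exact ⟨ρ, P.south ρ γ, γ, R, γ', D, rP, rP', aP, aP', hlt, c1, c2, hws.1.trans hi, hws.2⟩

section
variable {P P' : PipeDream n} {i j γ R γ' : ℕ}

theorem FL.jn (F : FL P P' i j γ R γ') : j < n := F.D.bounds.2.2.2.1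

theorem FL.Ri (F : FL P P' i j γ R γ') : R < i := F.D.hR

theorem FL.dataP (F : FL P P' i j γ R γ') : P.pos i i = γ ∧ P.pos (i + 1) j = γ ∧ γ < P.pos i j := by
  obtain ⟨a1, a2, a3, a4, a5, a6, a7⟩ := P.arc_data F.D.hin F.c1 F.D.hw F.D.hs
  exact ⟨a4, a5, a6⟩

theorem FL.arcP (F : FL P P' i j γ R γ') : P.Arc i j := ⟨i, γ, F.D.hin, F.c1, F.D.hw, F.D.hs⟩

theorem FL.box' (F : FL P P' i j γ R γ') :
    P'.cross R γ' = false ∧ P'.west R γ' = j ∧ P'.south R γ' = i := by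
  have hin' := F.D.hin'
  have hz : Zone i γ R γ' R γ' := Or.inr (Or.inr ⟨rfl, le_refl _⟩)
  have w2 := F.D.west_zone (by omega) hz
  have s2 := F.D.south_zone hin' hz
  rw [F.w] at w2
  rw [F.s] at s2
  simp only [Equiv.swap_apply_left, Equiv.swap_apply_right] at w2 s2
  exact ⟨by rw [F.D.hb', F.c2]; rfl, w2, s2⟩

theorem FL.arc' (F : FL P P' i j γ R γ') : P'.Arc j i :=
  ⟨R, γ', F.D.hin', F.box'.1, F.box'.2.1, F.box'.2.2⟩

theorem FL.act' (F : FL P P' i j γ R γ') : P'.Active R i ∧ P'.Active R j ∧ P'.pos R j = γ' ∧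
    P'.pos (R + 1) i = γ' := by
  obtain ⟨a1, a2, a3, a4, a5, a6, a7⟩ := P'.arc_data F.D.hin' F.box'.1 F.box'.2.1 F.box'.2.2
  exact ⟨a2, a1, a4, a5⟩

theorem FL.crossP (F : FL P P' i j γ R γ') : P.Active R i ∧ P.pos (R + 1) j = γ' ∧ P.pos R j = γ' ∧
    γ' < P.pos R i ∧ P.pos (R + 1) i < γ' := by
  obtain ⟨a1, a2, a3, a4, a5, a6, a7⟩ := P.cross_data F.c2 F.w F.s
  have := F.Ri
  exact ⟨a1, a4, a5, a6, by omega⟩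

theorem FL.ordP (F : FL P P' i j γ R γ') {r : ℕ} (h1 : R < r) (h2 : r ≤ i) :
    P.pos r i < P.pos r j := by
  have hij := F.hij
  have hjn := F.jn
  by_contra hcon
  have hne := P.pos_ne (r := r) (u := i) (v := j) (by omega) (by omega) (by omega) F.jn (by omega)
  have := F.rP.persist F.hij F.jn (r := r) (r' := R + 1) h2 (by omega) (by omega)
  have := F.crossP
  omega

theorem FL.pos_i (F : FL P P' i j γ R γ') {r : ℕ} (h1 : R < r) (h2 : r ≤ i) :
    P'.pos r i = P.pos r j := F.D.pos_in_x h1 h2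

theorem FL.pos_j (F : FL P P' i j γ R γ') {r : ℕ} (h1 : R < r) (h2 : r ≤ i) :
    P'.pos r j = P.pos r i := F.D.pos_in_y h1 h2

theorem FL.pos_k (F : FL P P' i j γ R γ') {r k : ℕ} (hr : r ≤ k) (hk : k < n) (h1 : k ≠ i)
    (h2 : k ≠ j) : P'.pos r k = P.pos r k := by
  by_cases h : R < r ∧ r ≤ i
  · exact F.D.pos_in hr hk h.1 h.2 h1 h2
  · exact F.D.pos_out hr hk h

theorem FL.pos_same (F : FL P P' i j γ R γ') {r k : ℕ} (hr : r ≤ k) (hk : k < n)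
    (h : r ≤ R ∨ i < r) : P'.pos r k = P.pos r k :=
  F.D.pos_out hr hk (by omega)

theorem FL.bl (F : FL P P' i j γ R γ') {u : ℕ} (hu : R < u) (hun : u < n)
    (h1 : P.pos (R + 1) i < P.pos (R + 1) u) (h2 : P.pos (R + 1) u < P.pos (R + 1) j) :
    i < u ∧ j < u := by
  have hui : u ≠ i := by rintro rfl; omega
  have huj : u ≠ j := by rintro rfl; omega
  have hc := F.crossP
  have ha := F.act'
  have hRi := F.Ri
  have hp := F.pos_k (r := R + 1) hu hun hui huj
  have hpj := F.pos_j (r := R + 1) (by omega) hRi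
  have k1 := P.active_cross hc.1 hu hun (Or.inr h1) (by omega)
  have k2 := P'.active_cross ha.2.1 hu hun (Or.inr (by omega)) (by omega)
  have l1 := F.rP _ _ k1.1
  have l2 := F.rP' _ _ k2.1
  omega

theorem FL.aft_i (F : FL P P' i j γ R γ') {r u : ℕ} (h1 : R < r) (h2 : r ≤ i) (hu : r ≤ u)
    (hun : u < n) (h : P'.pos r i < P'.pos r u) : P'.Path i u :=
  F.rP'.f4' h1 hu hun h2 F.act'.1 h

theorem FL.aft_j (F : FL P P' i j γ R γ') {r u : ℕ} (h1 : R < r) (h2 : r ≤ j) (hu : r ≤ u)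
    (hun : u < n) (h : P'.pos r j < P'.pos r u) : P'.Path j u :=
  F.rP'.f4' h1 hu hun h2 F.act'.2.1 h

theorem swap_cases (x y v : ℕ) : (v = x ∧ Equiv.swap x y v = y) ∨ (v = y ∧ Equiv.swap x y v = x) ∨
    (v ≠ x ∧ v ≠ y ∧ Equiv.swap x y v = v) := by
  by_cases h1 : v = x
  · subst h1; simp
  by_cases h2 : v = y
  · subst h2; simp
  exact Or.inr (Or.inr ⟨h1, h2, swap_ne h1 h2⟩)

theorem FL.arc_of' (F : FL P P' i j γ R γ') {a c : ℕ} (h : P'.Arc a c) :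
    P.Path a c ∨ (P.Path a j ∧ P.Path i c) := by
  obtain ⟨r, k, h1, h2, h3, h4⟩ := h
  have hb : ¬ (r = i ∧ k = γ) := by
    rintro ⟨rfl, rfl⟩
    have := F.D.hb
    rw [F.c1, h2] at this; exact absurd this (by decide)
  have hP := F.arcP.path
  by_cases hb' : r = R ∧ k = γ'
  · obtain ⟨rfl, rfl⟩ := hb'
    right
    rw [← h3, ← h4, F.box'.2.1, F.box'.2.2]
    exact ⟨Path.rfl', Path.rfl'⟩
  have hc : P.cross r k = false := by rw [← F.D.hoth r k hb hb']; exact h2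
  by_cases hz : Zone i γ R γ' r k
  · rw [F.D.west_zone (by omega) hz] at h3
    rw [F.D.south_zone h1 hz] at h4
    have harc : P.Path (P.west r k) (P.south r k) := Arc.path (P := P) ⟨r, k, h1, hc, rfl, rfl⟩
    rcases swap_cases i j (P.west r k) with ⟨e1, e2⟩ | ⟨e1, e2⟩ | ⟨e0, e1, e2⟩ <;>
    rcases swap_cases i j (P.south r k) with ⟨f1, f2⟩ | ⟨f1, f2⟩ | ⟨f0, f1, f2⟩ <;>
    rw [e2] at h3 <;> rw [f2] at h4 <;> subst h3 h4
    · rw [e1, f1] at harc; exact Or.inl Path.rfl'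
    · exact Or.inr ⟨Path.rfl', Path.rfl'⟩
    · rw [e1] at harc; exact Or.inr ⟨Path.rfl', harc⟩
    · exact Or.inl hP
    · exact Or.inr ⟨hP, Path.rfl'⟩
    · rw [e1] at harc; exact Or.inl (hP.trans' harc)
    · rw [f1] at harc; exact Or.inl (harc.trans' hP)
    · rw [f1] at harc; exact Or.inr ⟨harc, Path.rfl'⟩
    · exact Or.inl harc
  · rw [F.D.west_nzone (by omega) hz] at h3
    rw [F.D.south_nzone h1 hz] at h4
    exact Or.inl (Arc.path (P := P) ⟨r, k, h1, hc, h3, h4⟩)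

theorem FL.path_of' (F : FL P P' i j γ R γ') {a c : ℕ} (h : P'.Path a c) :
    P.Path a c ∨ (P.Path a j ∧ P.Path i c) := by
  unfold Path at h
  induction h with
  | refl => exact Or.inl Path.rfl'
  | tail _ h2 ih =>
    rcases ih with ih | ih <;> rcases F.arc_of' h2 with h | h
    · exact Or.inl (ih.trans' h)
    · exact Or.inr ⟨ih.trans' h.1, h.2⟩
    · exact Or.inr ⟨ih.1, ih.2.trans' h⟩
    · exact Or.inr ⟨ih.1, h.2⟩

theorem FL.arc_to' (F : FL P P' i j γ R γ') {a c : ℕ} (h : P.Arc a c) :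
    P'.Path a c ∨ (P'.Path a i ∧ P'.Path j c) := by
  obtain ⟨r, k, h1, h2, h3, h4⟩ := h
  have hb' : ¬ (r = R ∧ k = γ') := by
    rintro ⟨rfl, rfl⟩
    rw [F.c2] at h2; exact absurd h2 (by decide)
  have hP := F.arc'.path
  by_cases hb : r = i ∧ k = γ
  · obtain ⟨rfl, rfl⟩ := hb
    right
    rw [← h3, ← h4, F.D.hw, F.D.hs]
    exact ⟨Path.rfl', Path.rfl'⟩
  have hc : P'.cross r k = false := by rw [F.D.hoth r k hb hb']; exact h2
  have harc : P'.Path (P'.west r k) (P'.south r k) := Arc.path (P := P') ⟨r, k, h1, hc, rfl, rfl⟩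
  by_cases hz : Zone i γ R γ' r k
  · rw [F.D.west_zone (by omega) hz, F.D.south_zone h1 hz, h3, h4] at harc
    rcases swap_cases i j a with ⟨e1, e2⟩ | ⟨e1, e2⟩ | ⟨e0, e1, e2⟩ <;>
    rcases swap_cases i j c with ⟨f1, f2⟩ | ⟨f1, f2⟩ | ⟨f0, f1, f2⟩ <;>
    rw [e2, f2] at harc
    · rw [e1, f1]; exact Or.inl Path.rfl'
    · rw [e1, f1]; exact Or.inr ⟨Path.rfl', Path.rfl'⟩
    · rw [e1]; exact Or.inr ⟨Path.rfl', harc⟩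
    · rw [e1, f1]; exact Or.inl hP
    · rw [e1, f1]; exact Or.inr ⟨hP, Path.rfl'⟩
    · rw [e1]; exact Or.inl (hP.trans' harc)
    · rw [f1]; exact Or.inl (harc.trans' hP)
    · rw [f1]; exact Or.inr ⟨harc, Path.rfl'⟩
    · exact Or.inl harc
  · rw [F.D.west_nzone (by omega) hz, F.D.south_nzone h1 hz, h3, h4] at harc
    exact Or.inl harc

theorem FL.path_to' (F : FL P P' i j γ R γ') {a c : ℕ} (h : P.Path a c) :
    P'.Path a c ∨ (P'.Path a i ∧ P'.Path j c) := by
  unfold Path at h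
  induction h with
  | refl => exact Or.inl Path.rfl'
  | tail _ h2 ih =>
    rcases ih with ih | ih <;> rcases F.arc_to' h2 with h | h
    · exact Or.inl (ih.trans' h)
    · exact Or.inr ⟨ih.trans' h.1, h.2⟩
    · exact Or.inr ⟨ih.1, ih.2.trans' h⟩
    · exact Or.inr ⟨ih.1, h.2⟩

theorem FL.d' (F : FL P P' i j γ R γ') {k : ℕ} (h1 : P.Path i k) (h2 : P.Path k j) :
    k = i ∨ k = j := by
  by_contra hcon
  push Not at hcon
  have hij := F.hij
  have hRi := F.Ri
  have hjn := F.jn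
  rcases Relation.ReflTransGen.cases_tail h2 with h | ⟨k', g1', g2'⟩
  · exact hcon.2 h.symm
  have p1 : P.Path i k' := h1.trans' g1'
  have hki : k' ≠ i := by
    rintro rfl
    exact hcon.1 (F.aP.antisymm g1' h1)
  have hkl := Arc.lt P g2'
  have hkj : k' ≠ j := hkl.2.2
  have hkn := hkl.1
  clear h1 h2 g1' hcon
  have pj : P'.Path j k' := by
    rcases F.path_to' p1 with h | h
    · exact F.arc'.path.trans' h
    · exact h.2
  obtain ⟨ρ, c, e1, e2, e3, e4⟩ := id g2'
  obtain ⟨a1, a2, a3, a4, a5, a6, a7⟩ := P.arc_data e1 e2 e3 e4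
  have hdP := F.dataP
  have hcP := F.crossP
  have hb : ¬ (ρ = i ∧ c = γ) := by
    rintro ⟨rfl, rfl⟩
    rw [F.D.hw] at e3; exact hki e3.symm
  have hb' : ¬ (ρ = R ∧ c = γ') := by
    rintro ⟨rfl, rfl⟩
    rw [F.c2] at e2; exact absurd e2 (by decide)
  have hc : P'.cross ρ c = false := by rw [F.D.hoth ρ c hb hb']; exact e2
  have hz : Zone i γ R γ' ρ c := by
    by_contra hz
    have w2 := F.D.west_nzone (by omega) hz
    have s2 := F.D.south_nzone e1 hz
    have harc : P'.Arc k' j := ⟨ρ, c, e1, hc, w2.trans e3, s2.trans e4⟩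
    exact hkj (F.aP'.antisymm harc.path pj)
  have harc : P'.Arc k' i := by
    refine ⟨ρ, c, e1, hc, ?_, ?_⟩
    · rw [F.D.west_zone (by omega) hz, e3, swap_ne hki hkj]
    · rw [F.D.south_zone e1 hz, e4]; simp
  have hρ : R < ρ ∧ ρ < i := by
    rcases hz with h | ⟨h, h'⟩ | ⟨h, h'⟩
    · exact h
    · subst h; omega
    · subst h; omega
  have o1 := F.ordP (r := ρ + 1) (by omega) (by omega)
  have pi := F.pos_i (r := ρ + 1) (by omega) (by omega)
  have pj1 := F.pos_j (r := ρ + 1) (by omega) (by omega)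
  have key : k' < i ∧ P.pos ρ i < P.pos ρ k' := by
    rcases a7 with h | ⟨h, h'⟩
    · refine ⟨by omega, ?_⟩
      have := P.active_cross a1 (u := i) (by omega) (by omega) (Or.inl h) (by omega)
      omega
    · have pk := F.pos_k (r := ρ + 1) h hkn hki hkj
      have hne := P.pos_ne (r := ρ + 1) (u := k') (v := i) (by omega) hkn (by omega) (by omega) hki
      have hik : P.pos (ρ + 1) i < P.pos (ρ + 1) k' := by
        by_contra hlt
        have := P.active_cross a1 (u := i) (by omega) (by omega) (Or.inr (by omega)) (by omega)
        have hl := F.rP _ _ this.1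
        have := F.rP.f3 (r := ρ + 1) (u := k') (v := i) (by omega) (by omega) (by omega) (by omega)
        exact hki (F.aP.antisymm this p1)
      rcases Nat.lt_or_gt_of_ne hki with hlt | hgt
      · exact ⟨hlt, F.rP.persist1 hlt (by omega) (by omega) hik⟩
      · exfalso
        rcases Nat.lt_or_gt_of_ne hkj with hlt2 | hgt2
        · have g := g1 F.rP' F.aP' hlt2 pj
          rw [F.pos_same (by omega) hjn (Or.inr hgt), F.pos_same (by omega) hkn (Or.inr hgt)] at g
          have := F.rP.persist hlt2 hjn (r := k') (r' := ρ + 1) (le_refl _) g (by omega)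
          omega
        · have g := g1 F.rP F.aP hgt2 g2'.path
          rw [← F.pos_same (by omega) hjn (Or.inr hij), ← F.pos_same (by omega) hkn (Or.inr hij)] at g
          have := F.rP'.persist hgt2 hkn (r := j) (r' := ρ + 1) (le_refl _) g (by omega)
          omega
  have hρk : ρ ≤ k' := by omega
  have q := F.rP.persist key.1 (by omega) (r := ρ) (r' := R + 1) hρk key.2 (by omega)
  have hne := P.pos_ne (r := R + 1) (u := k') (v := j) (by omega) hkn (by omega) hjn hkj
  have hjk : P.pos (R + 1) j < P.pos (R + 1) k' := by
    by_contra hlt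
    have := F.bl (u := k') (by omega) hkn q (by omega)
    omega
  have := F.aft_i (r := R + 1) (u := k') (by omega) (by omega) (by omega) hkn (by
    rw [F.pos_i (by omega) (by omega), F.pos_k (by omega) hkn hki hkj]; exact hjk)
  exact hki (F.aP'.antisymm harc.path this)

end

end PipeDream


namespace PipeDream

variable {n : ℕ}

section
variable {P P' : PipeDream n} {i j γ R γ' : ℕ}

theorem FL.step_i (F : FL P P' i j γ R γ') {a : ℕ} (h1 : R < a) (h2 : a < i)
    (h : P.pos a i < P.pos a a) : P'.Path i a := by
  have hij := F.hij
  have hjn := F.jn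
  have q := F.rP.persist h2 (by omega) (r := a) (r' := R + 1) (le_refl _) h (by omega)
  have hne := P.pos_ne (r := R + 1) (u := a) (v := j) (by omega) (by omega) (by omega) hjn (by omega)
  have hja : P.pos (R + 1) j < P.pos (R + 1) a := by
    by_contra hlt
    have := F.bl (u := a) (by omega) (by omega) q (by omega)
    omega
  exact F.aft_i (r := R + 1) (u := a) (by omega) (by omega) (by omega) (by omega) (by
    rw [F.pos_i (by omega) (by omega), F.pos_k (by omega) (by omega) (by omega) (by omega)]
    exact hja)

theorem FL.step1 (F : FL P P' i j γ R γ') {a d : ℕ} (had : a < d) (hd : d < n)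
    (h : P.pos a d < P.pos a a) (hm : P.pos 0 d ≠ P.pos a d) : P'.Path d a := by
  have hij := F.hij
  have hjn := F.jn
  have hRi := F.Ri
  have h0 := F.pos_same (r := 0) (k := d) (by omega) hd (Or.inl (by omega))
  by_cases hs : a ≤ R ∨ i < a
  · have e1 := F.pos_same (r := a) (k := d) (by omega) hd hs
    have e2 := F.pos_same (r := a) (k := a) (by omega) (by omega) hs
    exact F.rP'.f4 (r := a) (r' := 0) (by omega) (by omega) (by omega) (by omega) hd (by omega)
      (by omega)
  by_cases hai : a = i
  · subst hai
    have o := F.ordP (r := a) (by omega) (by omega)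
    have hdj : d ≠ j := by rintro rfl; omega
    have e1 := F.pos_k (r := a) (k := d) (by omega) hd (by omega) hdj
    have e2 := F.pos_i (r := a) (by omega) (by omega)
    exact F.rP'.f4 (r := a) (r' := 0) (by omega) (by omega) (by omega) (by omega) hd (by omega)
      (by omega)
  have e2 := F.pos_k (r := a) (k := a) (by omega) (by omega) (by omega) (by omega)
  by_cases hdi : d = i
  · subst hdi
    exact F.step_i (by omega) had h
  by_cases hdj : d = j
  · subst hdj
    have o := F.ordP (r := a) (by omega) (by omega)
    have e1 := F.pos_j (r := a) (by omega) (by omega)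
    exact F.aft_j (r := a) (by omega) (by omega) (by omega) (by omega) (by omega)
  have e1 := F.pos_k (r := a) (k := d) (by omega) hd hdi hdj
  exact F.rP'.f4 (r := a) (r' := 0) (by omega) (by omega) (by omega) (by omega) hd (by omega)
      (by omega)

theorem active_after (P : PipeDream n) {a v : ℕ} (hact : P.Active a v) (hav : a < v) :
    P.pos a a ≤ P.pos (a + 1) v := by
  by_contra hcon
  have hvn := hact.1
  have := P.active_cross (P.active_self (by omega)) (u := v) hav hvn (Or.inl rfl) (by omega)
  rcases hact.2 with h | h <;> omega

theorem FL.si (F : FL P P' i j γ R γ') {a d : ℕ} (h1 : R ≤ a) (h2 : a < i) (had : a < d) (hd : d < n)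
    (h : P.pos (a + 1) i < P.pos (a + 1) d) (h' : P.pos a d < P.pos a a) :
    P'.Path i a := by
  have hij := F.hij
  have hjn := F.jn
  have hin : i < n := by omega
  have m1 := P.pos_mono had hd
  have m2 := P.pos_mono h2 hin
  have hna : ¬ P.Active a i := by
    intro hact
    have := P.active_after hact h2
    omega
  have hRa : R < a := by
    rcases Nat.lt_or_eq_of_le h1 with h | h
    · exact h
    · subst h; exact absurd F.crossP.1 hna
  refine F.step_i hRa h2 ?_
  by_contra hlt
  exact hna ⟨hin, Or.inr ⟨h2, by omega⟩⟩

theorem FL.mono (F : FL P P' i j γ R γ') {a b : ℕ} (hab : a < b) (h : P.Path b a) :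
    P'.Path b a := by
  have key : ∀ k a b, n - a ≤ k → a < b → P.Path b a → P'.Path b a := by
    intro k
    induction k with
    | zero =>
      intro a b hk hab h
      have := h.lt (by omega)
      omega
    | succ k ih =>
      intro a b hk hab h
      have hbn := (h.lt (by omega)).1
      have hij := F.hij
      have hjn := F.jn
      have hRi := F.Ri
      obtain ⟨d, had, hd, p1, p2, p3, p4⟩ := g2 F.rP F.aP hab h
      have s1 : P'.Path d a := F.step1 had hd p2 p3
      rcases Nat.lt_trichotomy d b with hdb | rfl | hbd
      · exact (ih d b (by omega) hdb p1).trans' s1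
      · exact s1
      have hord : P.pos (a + 1) b < P.pos (a + 1) d := by
        by_contra hlt
        have hne := P.pos_ne (r := a + 1) (u := b) (v := d) (by omega) hbn (by omega) hd (by omega)
        have m1 := P.pos_mono had hd
        have m2 := P.pos_mono' (r := a) (r' := 0) (v := d) (by omega) (by omega) hd
        have := F.rP.f4 (r := a + 1) (r' := 0) (u := b) (v := d) (by omega) (by omega) hbn (by omega)
          hd (by omega) (by omega)
        have := F.aP.antisymm this p1
        omega
      by_cases hs : a + 1 ≤ R ∨ i < a + 1
      · have e1 := F.pos_same (r := a + 1) (k := d) (by omega) hd hs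
        have e2 := F.pos_same (r := a + 1) (k := b) (by omega) (by omega) hs
        exact (F.rP'.f3 (r := a + 1) (by omega) hbd hd (by omega)).trans' s1
      have oij := F.ordP (r := a + 1) (by omega) (by omega)
      have pi := F.pos_i (r := a + 1) (by omega) (by omega)
      have pj := F.pos_j (r := a + 1) (by omega) (by omega)
      by_cases hbi : b = i
      · subst hbi
        exact F.si (by omega) hab had hd hord p2
      by_cases hbj : b = j
      · subst hbj
        have e1 := F.pos_k (r := a + 1) (k := d) (by omega) hd (by omega) (by omega)
        exact (F.aft_j (r := a + 1) (by omega) (by omega) (by omega) hd (by omega)).trans' s1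
      have eb := F.pos_k (r := a + 1) (k := b) (by omega) hbn hbi hbj
      by_cases hdi : d = i
      · subst hdi
        have := F.rP'.f3 (r := a + 1) (u := b) (v := j) (by omega) (by omega) hjn (by omega)
        exact (this.trans' F.arc'.path).trans' s1
      by_cases hdj : d = j
      · subst hdj
        have si := F.si (by omega) (by omega) had hd oij p2
        rcases Nat.lt_or_gt_of_ne hbi with hlt | hgt
        · exact (F.rP'.f3 (r := a + 1) (u := b) (v := i) (by omega) hlt (by omega)
            (by omega)).trans' si
        · by_cases hbi2 : P.pos (a + 1) b < P.pos (a + 1) i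
          · have := F.rP'.f3 (r := a + 1) (u := b) (v := d) (by omega) (by omega) hjn (by omega)
            exact (this.trans' F.arc'.path).trans' si
          · exfalso
            have hne := P.pos_ne (r := a + 1) (u := b) (v := i) (by omega) hbn (by omega) (by omega)
              hbi
            have q1 := F.rP'.persist hgt hbn (r := a + 1) (r' := R + 1) (by omega) (by omega)
              (by omega)
            have q2 := F.rP'.persist hbd hd (r := a + 1) (r' := R + 1) (by omega) (by omega)
              (by omega)
            rw [F.pos_k (by omega) hbn hbi hbj] at q1 q2
            rw [F.pos_i (by omega) (by omega)] at q1
            rw [F.pos_j (by omega) (by omega)] at q2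
            have := F.bl (u := b) (by omega) hbn q2 q1
            omega
      have e1 := F.pos_k (r := a + 1) (k := d) (by omega) hd hdi hdj
      exact (F.rP'.f3 (r := a + 1) (by omega) hbd hd (by omega)).trans' s1
  exact key _ a b (le_refl _) hab h

end

end PipeDream


namespace PipeDream

variable {n : ℕ}

theorem step_down {ω σ σ' : Equiv.Perm (Fin n)} {Q : PipeDream n} (hQ : Q.Red)
    (hω : Q.HasExitPerm ω) (hL : Q.LinExt σ') {i j : ℕ} (hij : i < j) (hj : j < n)
    (h1 : rk σ' i = rk σ' j + 1) (h2 : rk σ i = rk σ' j) (h3 : rk σ j = rk σ' i)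
    (h4 : ∀ k, k ≠ i → k ≠ j → rk σ k = rk σ' k) :
    Q.LinExt σ ∨ ∃ P : PipeDream n, P.Red ∧ P.HasExitPerm ω ∧ P.LinExt σ ∧ P.IncFlip Q := by
  have hred := hQ.reduced
  have hac : Q.Acyclic := hL.acyclic
  have hL' := (linExt_iff _ _).1 hL
  have hin0 : i < n := by omega
  have adj : ∀ u v, u < n → v < n → rk σ' u < rk σ' v → ¬ (u = j ∧ v = i) → rk σ u < rk σ v := by
    intro u v hu hv h hne
    have A : ∀ w, w < n → (w = i ∧ rk σ w = rk σ' j ∧ rk σ' w = rk σ' i) ∨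
        (w = j ∧ rk σ w = rk σ' i ∧ rk σ' w = rk σ' j) ∨
        (w ≠ i ∧ w ≠ j ∧ rk σ w = rk σ' w ∧ rk σ' w ≠ rk σ' i ∧ rk σ' w ≠ rk σ' j) := by
      intro w hw
      by_cases a1 : w = i
      · subst a1; exact Or.inl ⟨rfl, h2, rfl⟩
      by_cases a2 : w = j
      · subst a2; exact Or.inr (Or.inl ⟨rfl, h3, rfl⟩)
      exact Or.inr (Or.inr ⟨a1, a2, h4 w a1 a2, fun e => a1 (rk_inj _ hw hin0 e),
        fun e => a2 (rk_inj _ hw hj e)⟩)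
    have Au := A u hu
    have Av := A v hv
    omega
  by_cases harc : ∃ R, ∃ c, R + c + 2 ≤ n ∧ Q.cross R c = false ∧ Q.west R c = j ∧ Q.south R c = i
  swap
  · left
    rw [linExt_iff]
    intro u v hA
    have hl := Arc.lt Q hA
    refine adj u v hl.1 hl.2.1 (hL' u v hA) ?_
    rintro ⟨rfl, rfl⟩
    exact harc hA
  right
  classical
  have hRmin : ∀ r, (∃ c, r + c + 2 ≤ n ∧ Q.cross r c = false ∧ Q.west r c = j ∧ Q.south r c = i) →
    Nat.find harc ≤ r := fun r hr => Nat.find_min' harc hr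
  obtain ⟨γ', b1, b2, b3, b4⟩ := Nat.find_spec harc
  generalize Nat.find harc = R at *
  obtain ⟨a1, a2, a3, a4, a5, a6, a7⟩ := Q.arc_data b1 b2 b3 b4
  have hA : Q.Arc j i := ⟨R, γ', b1, b2, b3, b4⟩
  have g := g1 hQ hac hij hA.path
  have m := Q.pos_mono hij hj
  obtain ⟨e1, e2, e3, e4⟩ := Q.active_cross (Q.active_self hin0) hij hj (Or.inl rfl) (by omega)
  generalize hγ : Q.pos (i + 1) j = γ at *
  have hin := Q.inShape _ _ e1
  have ordQ : ∀ r, r ≤ i → Q.pos r j < Q.pos r i := fun r hr => hQ.persist hij hj (le_refl _) g hr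
  -- pipes between `j` and `i`
  have bl : ∀ u r, i < u → u < j → R < r → r ≤ i → Q.pos r j < Q.pos r u → Q.pos r u < Q.pos r i →
      False := by
    intro u r hu huj hRr hri p1 p2
    have q1 := hQ.persist huj hj (r := r) (r' := R + 1) (by omega) p1 (by omega)
    have q2 := hQ.persist hu (by omega) (r := r) (r' := R + 1) (by omega) p2 (by omega)
    have := Q.active_cross a1 (u := u) (by omega) (by omega) (Or.inr q1) (by omega)
    have := hQ _ _ this.1
    omega
  have hneb : ¬ (R = i ∧ γ' = γ) := by omega
  let P : PipeDream n := ⟨fun r c => if r = i ∧ c = γ then false else if r = R ∧ c = γ' then true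
    else Q.cross r c, by
      intro r c h
      by_cases k1 : r = i ∧ c = γ
      · rw [if_pos k1] at h; exact absurd h (by decide)
      rw [if_neg k1] at h
      by_cases k2 : r = R ∧ c = γ'
      · obtain ⟨rfl, rfl⟩ := k2; exact b1
      · rw [if_neg k2] at h; exact Q.inShape _ _ h⟩
  have hPb : P.cross i γ = false := if_pos ⟨rfl, rfl⟩
  have hPb' : P.cross R γ' = true := (if_neg hneb).trans (if_pos ⟨rfl, rfl⟩)
  have hPo : ∀ r c, ¬ (r = i ∧ c = γ) → ¬ (r = R ∧ c = γ') → P.cross r c = Q.cross r c :=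
    fun r c k1 k2 => (if_neg k1).trans (if_neg k2)
  clear_value P
  have D : FlipData Q P i γ R γ' i j :=
    { hR := a3, hin := hin, hin' := b1, hoth := hPo
      hb := by rw [hPb, e1]; rfl
      hb' := by rw [hPb', b2]; rfl
      hw := e2, hs := e3, hws := Or.inr ⟨b3, b4⟩ }
  have hnz : ¬ Zone i γ R γ' i γ := by unfold Zone; omega
  have hz : Zone i γ R γ' R γ' := Or.inr (Or.inr ⟨rfl, le_refl _⟩)
  have Pw : P.west i γ = i := (D.west_nzone (by omega) hnz).trans e2
  have Ps : P.south i γ = j := (D.south_nzone hin hnz).trans e3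
  have Pw' : P.west R γ' = i := by rw [D.west_zone (by omega) hz, b3]; simp
  have Ps' : P.south R γ' = j := by rw [D.south_zone b1 hz, b4]; simp
  refine ⟨P, ?_, D.hasExit hω, ?_, ?_⟩
  · intro r c hc
    have k1 : ¬ (r = i ∧ c = γ) := by
      rintro ⟨rfl, rfl⟩; rw [hPb] at hc; exact absurd hc (by decide)
    by_cases k2 : r = R ∧ c = γ'
    · obtain ⟨rfl, rfl⟩ := k2; rw [Pw', Ps']; exact hij
    rw [hPo r c k1 k2] at hc
    have hlt := hQ r c hc
    have hrc := Q.inShape _ _ hc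
    by_cases hzz : Zone i γ R γ' r c
    swap
    · rw [D.west_nzone (by omega) hzz, D.south_nzone hrc hzz]; exact hlt
    rw [D.west_zone (by omega) hzz, D.south_zone hrc hzz]
    have hij' : ¬ (Q.west r c = i ∧ Q.south r c = j) := by
      intro h
      refine hred r c i γ hc e1 ?_ (Or.inl ⟨h.1.trans e2.symm, h.2.trans e3.symm⟩)
      intro he; rw [Prod.mk.injEq] at he; exact k1 he
    have hri : R ≤ r ∧ r ≤ i := by unfold Zone at hzz; omega
    have cd := Q.cross_data hc rfl rfl
    rcases swap_cases i j (Q.west r c) with ⟨s1, s2⟩ | ⟨s1, s2⟩ | ⟨s0, s1, s2⟩ <;>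
    rcases swap_cases i j (Q.south r c) with ⟨f1, f2⟩ | ⟨f1, f2⟩ | ⟨f0, f1, f2⟩ <;>
    rw [s2, f2]
    · omega
    · exact absurd ⟨s1, f1⟩ hij'
    · -- W = i, S = k
      by_contra hcon
      rw [s1] at cd hlt
      generalize Q.south r c = k at *
      obtain ⟨d1, d2, d3, d4, d5, d6, d7⟩ := cd
      have hRr : R < r := by
        rcases Nat.lt_or_eq_of_le hri.1 with h | h
        · exact h
        · subst h; unfold Zone at hzz; omega
      refine bl k r hlt (by omega) hRr hri.2 ?_ (by omega)
      rcases d7 with h | ⟨h, h'⟩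
      · subst h; unfold Zone at hzz; omega
      · have := ordQ (r + 1) (by omega)
        exact hQ.persist1 (by omega) hj (by omega) (by omega)
    · omega
    · omega
    · omega
    · omega
    · -- W = k, S = j
      by_contra hcon
      rw [f1] at cd hlt
      generalize Q.west r c = k at *
      obtain ⟨d1, d2, d3, d4, d5, d6, d7⟩ := cd
      have hRr : R < r := by
        rcases Nat.lt_or_eq_of_le hri.1 with h | h
        · exact h
        · subst h; omega
      have hr1 : r < i := by
        rcases Nat.lt_or_eq_of_le hri.2 with h | h
        · exact h
        · subst h; unfold Zone at hzz; omega
      refine bl k r (by omega) hlt hRr hri.2 (by omega) ?_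
      have := ordQ (r + 1) (by omega)
      exact hQ.persist1 (by omega) (by omega) (by omega) (by omega)
    · exact hlt
  · rw [linExt_iff]
    rintro u v ⟨r, c, k1, k2, rfl, rfl⟩
    by_cases k3 : r = i ∧ c = γ
    · obtain ⟨rfl, rfl⟩ := k3; rw [Pw, Ps]; omega
    have k4 : ¬ (r = R ∧ c = γ') := by
      rintro ⟨rfl, rfl⟩; rw [hPb'] at k2; exact absurd k2 (by decide)
    rw [hPo r c k3 k4] at k2
    have hA2 : Q.Arc (Q.west r c) (Q.south r c) := ⟨r, c, k1, k2, rfl, rfl⟩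
    have hlt := hL' _ _ hA2
    have hl := Arc.lt Q hA2
    by_cases hzz : Zone i γ R γ' r c
    · rw [D.west_zone (by omega) hzz, D.south_zone k1 hzz]
      have S : ∀ w, rk σ (Equiv.swap i j w) = rk σ' w := by
        intro w
        rcases swap_cases i j w with ⟨s1, s2⟩ | ⟨s1, s2⟩ | ⟨s0, s1, s2⟩
        · rw [s2, s1, h3]
        · rw [s2, s1, h2]
        · rw [s2, h4 w s0 s1]
      rw [S, S]; exact hlt
    · rw [D.west_nzone (by omega) hzz, D.south_nzone k1 hzz]
      refine adj _ _ hl.1 hl.2.1 hlt ?_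
      rintro ⟨s1, s2⟩
      have := hRmin r ⟨c, k1, k2, s1, s2⟩
      have ad := Q.arc_data k1 k2 s1 s2
      rcases Nat.lt_or_eq_of_le this with h | h
      · unfold Zone at hzz; omega
      · subst h; unfold Zone at hzz; omega
  · refine ⟨(i, γ), (R, γ'), ⟨?_, hPb, hPb', e1, b2, ?_, ?_⟩, le_of_lt a3, ?_⟩
    · intro he; rw [Prod.mk.injEq] at he; exact hneb ⟨he.1.symm, he.2.symm⟩
    · intro r c k1 k2
      exact hPo r c (fun h => k1 (by rw [h.1, h.2])) (fun h => k2 (by rw [h.1, h.2]))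
    · left
      simp only
      rw [Pw, Ps, Pw', Ps']; exact ⟨rfl, rfl⟩
    · have m1 := Q.pos_mono' (r := i) (r' := R + 1) (v := j) (by omega) (by omega) hj
      have m2 := ordQ (R + 1) (by omega)
      simp only
      omega

end PipeDream

open PipeDream

theorem GoodPD.red {n : ℕ} {ω : Equiv.Perm (Fin n)} {P : PipeDream n} (h : GoodPD ω P) : P.Red :=
  h.1.red

/-- going down in the weak order -/
theorem mono_down {n : ℕ} {ω σ τ : Equiv.Perm (Fin n)} {Q : PipeDream n} (hQ : GoodPD ω Q)
    (hL : Q.LinExt τ) (hle : WeakLE σ τ) :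
    ∃ P, GoodPD ω P ∧ P.LinExt σ ∧ Relation.ReflTransGen (FlipStep ω) P Q := by
  refine weak_chain (σ := σ) (fun ρ => ∃ P, GoodPD ω P ∧ P.LinExt ρ ∧
    Relation.ReflTransGen (FlipStep ω) P Q) ?_ τ hle ⟨Q, hQ, hL, Relation.ReflTransGen.refl⟩
  rintro τ τ2 i j ⟨P, hP, hPL, hPQ⟩ hij hj h1 h2 h3 h4
  rcases step_down hP.red hP.2.1 hPL hij hj h1 h2 h3 h4 with h | ⟨P', r, e, l, f⟩
  · exact ⟨P, hP, h, hPQ⟩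
  · have g : GoodPD ω P' := ⟨r.reduced, e, l.acyclic⟩
    exact ⟨P', g, l, Relation.ReflTransGen.head ⟨g, hP, f⟩ hPQ⟩

theorem flip_mono {n : ℕ} {ω : Equiv.Perm (Fin n)} {P Q : PipeDream n}
    (h : Relation.ReflTransGen (FlipStep ω) P Q) {a b : ℕ} (hab : a < b) (hp : P.Path b a) :
    Q.Path b a := by
  induction h with
  | refl => exact hp
  | tail _ h2 ih =>
    obtain ⟨i, j, γ, R, γ', F⟩ := h2.2.2.fl h2.1.red h2.2.1.red h2.1.2.2 h2.2.1.2.2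
    exact F.mono hab ih

theorem good_eq {n : ℕ} {ω π : Equiv.Perm (Fin n)} {P Q : PipeDream n} (hP : GoodPD ω P)
    (hQ : GoodPD ω Q) (h : P.LinExt π) (h' : Q.LinExt π) : P = Q :=
  eq_of_common hP.red hQ.red hP.2.1 hQ.2.1 h h'

theorem GoodPD.min {n : ℕ} {ω : Equiv.Perm (Fin n)} {P : PipeDream n} (h : GoodPD ω P) :
    ∃ π, P.LinExt π ∧ ∀ u v, u < v → v < n → (rk π v < rk π u ↔ P.Path v u) :=
  exists_min h.red h.2.2

theorem min_le {n : ℕ} {P : PipeDream n} {π τ : Equiv.Perm (Fin n)}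
    (h : ∀ u v, u < v → v < n → (rk π v < rk π u ↔ P.Path v u)) (hτ : P.LinExt τ) :
    WeakLE π τ := by
  rw [weakLE_iff]
  intro i j hij hj hr
  have := (h i j hij hj).1 hr
  have h1 := hτ.path this
  rcases Nat.lt_or_eq_of_le h1 with h2 | h2
  · exact h2
  · have := rk_inj _ hj (by omega) h2; omega

/-- flips increase the minimum -/
theorem flip_min {n : ℕ} {ω : Equiv.Perm (Fin n)} {P Q : PipeDream n}
    (h : Relation.ReflTransGen (FlipStep ω) P Q) {π τ : Equiv.Perm (Fin n)}
    (hπ : ∀ u v, u < v → v < n → (rk π v < rk π u ↔ P.Path v u))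
    (hτ : ∀ u v, u < v → v < n → (rk τ v < rk τ u ↔ Q.Path v u)) : WeakLE π τ := by
  rw [weakLE_iff]
  intro i j hij hj hr
  exact (hτ i j hij hj).2 (flip_mono h hij ((hπ i j hij hj).1 hr))

/-- if some linear extension of `P` is below one of `Q` then `P` is below `Q` in the flip order -/
theorem le_of_weak {n : ℕ} {ω π τ : Equiv.Perm (Fin n)} {P Q : PipeDream n} (hP : GoodPD ω P)
    (hQ : GoodPD ω Q) (h : P.LinExt π) (h' : Q.LinExt τ) (hle : WeakLE π τ) :
    Relation.ReflTransGen (FlipStep ω) P Q := by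
  obtain ⟨P', g, l, f⟩ := mono_down hQ h' hle
  rwa [good_eq hP g h l]

theorem quotLE_iff {n : ℕ} {ω : Equiv.Perm (Fin n)} {P Q : PipeDream n} (hP : GoodPD ω P)
    (hQ : GoodPD ω Q) : QuotLE P Q ↔ Relation.ReflTransGen (FlipStep ω) P Q := by
  constructor
  · rintro ⟨π, τ, h1, h2, h3⟩
    exact le_of_weak hP hQ h1 h2 h3
  · intro h
    obtain ⟨π, h1, h2⟩ := hP.min
    obtain ⟨τ, h3, h4⟩ := hQ.min
    exact ⟨π, τ, h1, h3, flip_min h h2 h4⟩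

theorem sameClass_iff {n : ℕ} {ω : Equiv.Perm (Fin n)} {P Q : PipeDream n} (hP : GoodPD ω P)
    (hQ : GoodPD ω Q) : SameClass P Q ↔ P = Q := by
  constructor
  · intro h
    obtain ⟨π, h1, h2⟩ := hP.min
    exact good_eq hP hQ h1 ((h π).1 h1)
  · rintro rfl π; exact Iff.rfl

theorem WeakLE.antisymm' {n : ℕ} {π τ : Equiv.Perm (Fin n)} (h1 : WeakLE π τ) (h2 : WeakLE τ π)
    {P : PipeDream n} (h : P.LinExt π) : P.LinExt τ := by
  rw [linExt_iff] at h ⊢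
  rw [weakLE_iff] at h1 h2
  intro i j ha
  have hl := Arc.lt P ha
  have := h i j ha
  by_contra hcon
  have hne : rk τ i ≠ rk τ j := fun e => hl.2.2 (rk_inj _ hl.1 hl.2.1 e)
  rcases Nat.lt_or_gt_of_ne hl.2.2 with hlt | hgt
  · have := h2 i j hlt hl.2.1 (by omega)
    omega
  · have := h1 j i hgt hl.1 this
    omega

theorem flip_antisymm {n : ℕ} {ω : Equiv.Perm (Fin n)} {P Q : PipeDream n} (hP : GoodPD ω P)
    (hQ : GoodPD ω Q) (h1 : Relation.ReflTransGen (FlipStep ω) P Q)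
    (h2 : Relation.ReflTransGen (FlipStep ω) Q P) : P = Q := by
  obtain ⟨π, a1, a2⟩ := hP.min
  obtain ⟨τ, b1, b2⟩ := hQ.min
  exact good_eq hP hQ ((flip_min h1 a2 b2).antisymm' (flip_min h2 b2 a2) a1) b1


namespace PipeDream

theorem FL.unique {n : ℕ} {P P' Q : PipeDream n} {i j γ R γ' a b δ S δ' : ℕ}
    (F : FL P P' i j γ R γ') (G : FL P Q a b δ S δ') (h : P'.Path b a) : Q = P' := by
  have pab := G.arcP.path
  have hab := G.hij
  have hij := F.hij
  rcases F.path_of' h with h | ⟨h1, h2⟩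
  · have := F.aP.antisymm h pab; omega
  have ka := F.d' h2 (pab.trans' h1)
  have kb := F.d' (h2.trans' pab) h1
  obtain ⟨rfl, rfl⟩ : a = i ∧ b = j := by omega
  have hγ : δ = γ := by rw [← F.dataP.1, ← G.dataP.1]
  subst hγ
  have hb : S = R ∧ δ' = γ' := by
    by_contra hne
    refine F.rP.reduced S δ' R γ' G.c2 F.c2 ?_
      (Or.inl ⟨G.w.trans F.w.symm, G.s.trans F.s.symm⟩)
    intro he; rw [Prod.mk.injEq] at he; exact hne he
  obtain ⟨rfl, rfl⟩ := hb
  apply ext_cross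
  intro r c
  by_cases k1 : r = a ∧ c = δ
  · obtain ⟨rfl, rfl⟩ := k1; rw [F.D.hb, G.D.hb]
  by_cases k2 : r = S ∧ c = δ'
  · obtain ⟨rfl, rfl⟩ := k2; rw [F.D.hb', G.D.hb']
  rw [F.D.hoth r c k1 k2, G.D.hoth r c k1 k2]

end PipeDream

/-- For any `ω ∈ S_n`, the map sending an acyclic pipe dream
`P ∈ Π(ω)` to its set `L(P)` of linear extensions is an isomorphism of directed
graphs from the increasing flip graph on acyclic pipe dreams of `Π(ω)` to the Hasse
diagram of the lattice quotient `[e, ω]/≡_ω` (oriented from lower to upper covers):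
it is injective (and it is onto the congruence classes by definition of `≡_ω`), and
there is an increasing flip from `P` to `P'` if and only if the class of `P'`
covers the class of `P` in the quotient.  In particular, the reflexive–transitive
closure of the increasing flip graph on acyclic pipe dreams of `Π(ω)` is a partial
order (reflexive, transitive, and antisymmetric) which is a lattice (any two
elements have a greatest lower bound and a least upper bound). -/
theorem incFlipGraph_iso_quotient (n : ℕ) (ω : Equiv.Perm (Fin n)) :
    (∀ P P' : PipeDream n, GoodPD ω P → GoodPD ω P' → SameClass P P' → P = P') ∧
    (∀ P P' : PipeDream n, GoodPD ω P → GoodPD ω P' →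
      (PipeDream.IncFlip P P' ↔ QuotCovBy ω P P')) ∧
    (∀ P P' : PipeDream n, GoodPD ω P → GoodPD ω P' →
      Relation.ReflTransGen (FlipStep ω) P P' →
      Relation.ReflTransGen (FlipStep ω) P' P → P = P') ∧
    (∀ P P' : PipeDream n, GoodPD ω P → GoodPD ω P' →
      (∃ M : PipeDream n, GoodPD ω M ∧
        Relation.ReflTransGen (FlipStep ω) M P ∧
        Relation.ReflTransGen (FlipStep ω) M P' ∧
        ∀ R : PipeDream n, GoodPD ω R →
          Relation.ReflTransGen (FlipStep ω) R P →
          Relation.ReflTransGen (FlipStep ω) R P' →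
          Relation.ReflTransGen (FlipStep ω) R M) ∧
      (∃ J : PipeDream n, GoodPD ω J ∧
        Relation.ReflTransGen (FlipStep ω) P J ∧
        Relation.ReflTransGen (FlipStep ω) P' J ∧
        ∀ R : PipeDream n, GoodPD ω R →
          Relation.ReflTransGen (FlipStep ω) P R →
          Relation.ReflTransGen (FlipStep ω) P' R →
          Relation.ReflTransGen (FlipStep ω) J R)) := by
  refine ⟨fun P P' hP hP' h => (sameClass_iff hP hP').1 h, fun P P' hP hP' => ⟨fun h => ?_, fun h => ?_⟩,
    fun P P' hP hP' h1 h2 => flip_antisymm hP hP' h1 h2, fun P P' hP hP' => ⟨?_, ?_⟩⟩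
  · have hstep : FlipStep ω P P' := ⟨hP, hP', h⟩
    obtain ⟨i, j, γ, R, γ', F⟩ := h.fl hP.red hP'.red hP.2.2 hP'.2.2
    refine ⟨⟨(quotLE_iff hP hP').2 (Relation.ReflTransGen.single hstep), ?_⟩, ?_⟩
    · rw [sameClass_iff hP hP']
      rintro rfl
      have := F.D.hb
      revert this; cases P.cross i γ <;> decide
    · rintro Q hQ ⟨h1, h2⟩ ⟨h3, h4⟩
      rw [quotLE_iff hP hQ] at h1
      rw [quotLE_iff hQ hP'] at h3
      rw [sameClass_iff hP hQ] at h2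
      rw [sameClass_iff hQ hP'] at h4
      rcases Relation.ReflTransGen.cases_head h1 with h5 | ⟨Q1, h5, h6⟩
      · exact h2 h5
      obtain ⟨a, b, δ, S, δ', G⟩ := h5.2.2.fl h5.1.red h5.2.1.red h5.1.2.2 h5.2.1.2.2
      have heq : Q1 = P' := F.unique G (flip_mono (h6.trans h3) G.hij G.arc'.path)
      rw [heq] at h6
      exact h4 (flip_antisymm hQ hP' h3 h6)
  · obtain ⟨⟨h1, h2⟩, h3⟩ := h
    rw [quotLE_iff hP hP'] at h1
    rcases Relation.ReflTransGen.cases_head h1 with h5 | ⟨Q, h5, h6⟩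
    · exact absurd ((sameClass_iff hP hP').2 h5) h2
    have hQ := h5.2.1
    by_cases hQP : Q = P'
    · rw [← hQP]; exact h5.2.2
    exfalso
    obtain ⟨i, j, γ, R, γ', F⟩ := h5.2.2.fl hP.red hQ.red hP.2.2 hQ.2.2
    refine h3 Q hQ ⟨(quotLE_iff hP hQ).2 (Relation.ReflTransGen.single h5), ?_⟩
      ⟨(quotLE_iff hQ hP').2 h6, fun h => hQP ((sameClass_iff hQ hP').1 h)⟩
    rw [sameClass_iff hP hQ]
    rintro rfl
    have := F.D.hb
    revert this; cases P.cross i γ <;> decide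
  · obtain ⟨π, p1, p2⟩ := hP.min
    obtain ⟨π', p1', p2'⟩ := hP'.min
    obtain ⟨κ, k1, k2⟩ := exists_weak_join (fun τ : Equiv.Perm (Fin n) => ∃ R : PipeDream n,
      GoodPD ω R ∧ Relation.ReflTransGen (FlipStep ω) R P ∧
      Relation.ReflTransGen (FlipStep ω) R P' ∧ R.LinExt τ ∧
      ∀ u v, u < v → v < n → (rk τ v < rk τ u ↔ R.Path v u))
    have e1 : WeakLE κ π := k2 π (by
      rintro τ ⟨R, r1, r2, r3, r4, r5⟩
      exact flip_min r2 r5 p2)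
    have e2 : WeakLE κ π' := k2 π' (by
      rintro τ ⟨R, r1, r2, r3, r4, r5⟩
      exact flip_min r3 r5 p2')
    obtain ⟨M, m1, m2, m3⟩ := mono_down hP p1 e1
    refine ⟨M, m1, m3, le_of_weak m1 hP' m2 p1' e2, ?_⟩
    intro R hR hRP hRP'
    obtain ⟨τ, t1, t2⟩ := hR.min
    exact le_of_weak hR m1 t1 m2 (k1 τ ⟨R, hR, hRP, hRP', t1, t2⟩)
  · obtain ⟨π, p1, p2⟩ := hP.min
    obtain ⟨π', p1', p2'⟩ := hP'.min
    obtain ⟨κ, k1, k2⟩ := exists_weak_join (fun τ : Equiv.Perm (Fin n) => τ = π ∨ τ = π')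
    have e : WeakLE κ ω := k2 ω (by
      rintro τ (rfl | rfl)
      · exact p1.weakLE hP.red hP.2.1
      · exact p1'.weakLE hP'.red hP'.2.1)
    obtain ⟨T, t1, t2, t3⟩ := PipeDream.exists_top ω
    obtain ⟨J, j1, j2, j3⟩ := mono_down (ω := ω) (Q := T) ⟨t1.reduced, t2, t3.acyclic⟩ t3 e
    refine ⟨J, j1, le_of_weak hP j1 p1 j2 (k1 π (Or.inl rfl)),
      le_of_weak hP' j1 p1' j2 (k1 π' (Or.inr rfl)), ?_⟩
    intro R hR h1 h2
    obtain ⟨ρ, r1, r2⟩ := hR.min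
    refine le_of_weak j1 hR j2 r1 (k2 ρ ?_)
    rintro τ (rfl | rfl)
    · exact flip_min h1 p2 r2
    · exact flip_min h2 p2' r2
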